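/- arXiv:2110.06749 — 3 statements merged into one kernel-verified Lean document; each statement's English description precedes it below -/
import Mathlib

section
/- With R the completed determinantal ring and I the ideal generated by the entries of the first n−1 columns, one has: the Krull dimension of R/I equals m, the height of I equals n−1, and the grade of I (the maximal length of an R-regular sequence contained in I) equals n−1. -/
open CategoryTheory Opposite MvPowerSeries

set_option synthInstance.maxHeartbeats 1000000
set_option maxHeartbeats 1000000

noncomputable section

/-- The grade of an ideal: the maximal length of a regular sequence contained in it. -/
def idealGrade {A : Type} [CommRing A] (J : Ideal A) : ℕ∞ :=
  sSup {c : ℕ∞ | ∃ rs : List A, (∀ r ∈ rs, r ∈ J) ∧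
    RingTheory.Sequence.IsRegular A rs ∧ (rs.length : ℕ∞) = c}

/-- The height of an ideal: the infimum of heights of primes containing it. -/
def idealHeight {A : Type} [CommRing A] (J : Ideal A) : ℕ∞ :=
  sInf {h : ℕ∞ | ∃ p : PrimeSpectrum A, J ≤ p.asIdeal ∧ Order.height p = h}

/-- A canonical module of a `d`-dimensional local ring `A`: a finitely generated module `ω`
with `Ext_A^i(𝕜, ω) = 0` for `i ≠ d` and `Ext_A^d(𝕜, ω)` a one-dimensional `𝕜`-vector space
(equivalently, isomorphic to `𝕜` as an `A`-module), where `𝕜` is the residue field. -/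
def IsCanonicalModule (A : Type) [CommRing A] [IsLocalRing A] (d : ℕ)
    (ω : ModuleCat A) : Prop :=
  Module.Finite A ω ∧
  (∀ i : ℕ, i ≠ d → Subsingleton
    (((Ext A (ModuleCat A) i).obj
      (op (ModuleCat.of A (IsLocalRing.ResidueField A)))).obj ω)) ∧
  Nonempty ((((Ext A (ModuleCat A) d).obj
      (op (ModuleCat.of A (IsLocalRing.ResidueField A)))).obj ω)
    ≃ₗ[A] IsLocalRing.ResidueField A)

variable (𝕜 : Type) [Field 𝕜] (m n : ℕ)

/-- The formal power series ring `P` in the entries of an `m × n` matrix of variables. -/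
abbrev DetP := MvPowerSeries (Fin m × Fin n) 𝕜

/-- The ideal of `P` generated by the `2 × 2` minors of the matrix of variables. -/
def detI2 : Ideal (DetP 𝕜 m n) :=
  Ideal.span {f | ∃ (i k : Fin m) (j l : Fin n), i < k ∧ j < l ∧
    f = X (i, j) * X (k, l) - X (i, l) * X (k, j)}

/-- The complete determinantal ring `R = P/I₂(X)`. -/
abbrev DetR := DetP 𝕜 m n ⧸ detI2 𝕜 m n

/-- The residue class in `R` of the variable `x_{ij}`. -/
def detx (i : Fin m) (j : Fin n) : DetR 𝕜 m n :=
  Ideal.Quotient.mk (detI2 𝕜 m n) (X (i, j))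

/-- The ideal `I` of `R` generated by the entries of the first `n - 1` columns. -/
def detJ : Ideal (DetR 𝕜 m n) :=
  Ideal.span {x | ∃ (i : Fin m) (j : Fin n), (j : ℕ) < n - 1 ∧ x = detx 𝕜 m n i j}

/-- The formal power series ring `S = 𝕜[[x_1, …, x_m, a_1, …, a_{n-1}]]`. -/
abbrev DetS := MvPowerSeries (Fin m ⊕ Fin (n - 1)) 𝕜

/-- The ideal `𝔞 = (a_1, …, a_{n-1})S`. -/
def detA : Ideal (DetS 𝕜 m n) :=
  Ideal.span {f | ∃ j : Fin (n - 1), f = X (Sum.inr j)}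

/-- The property pinning down the local `𝕜`-algebra homomorphism `φ : R → S`:
`x_{ij} ↦ a_j·x_i` for `1 ≤ j ≤ n-1` and `x_{in} ↦ x_i` (in `0`-based indexing, the last
column is `j = n-1`).  Any `𝕜`-algebra homomorphism `R → S` with these values on the
variables automatically maps the maximal ideal into the maximal ideal, hence is continuous
and is uniquely determined by these values; so this predicate characterizes `φ`. -/
def IsDetPhi (φ : DetR 𝕜 m n →ₐ[𝕜] DetS 𝕜 m n) : Prop :=
  ∀ (i : Fin m) (j : Fin n),
    φ (detx 𝕜 m n i j) =
      if h : (j : ℕ) < n - 1 then X (Sum.inr (⟨j, h⟩ : Fin (n - 1))) * X (Sum.inl i)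
      else X (Sum.inl i)

section PowerSeriesIdeals

variable {σ K : Type*} [Field K]

theorem mem_span_X_image_mul_of_coeff_eq_zero {N : ℕ} {𝔞 : Ideal (MvPowerSeries σ K)}
    (h𝔞 : ∀ q : MvPowerSeries σ K, (∀ d, d.degree < N → coeff d q = 0) → q ∈ 𝔞)
    (s : Finset σ) (f : MvPowerSeries σ K)
    (hs : ∀ d, (∀ a ∈ s, d a = 0) → coeff d f = 0)
    (hN : ∀ d, d.degree ≤ N → coeff d f = 0) :
    f ∈ Ideal.span ((X : σ → MvPowerSeries σ K) '' s) * 𝔞 := by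
  classical
  induction s using Finset.induction_on generalizing f with
  | empty =>
    have : f = 0 := by
      ext d
      exact hs d (by simp)
    simp [this]
  | insert a s _ ih =>
    let g : MvPowerSeries σ K := fun d => if d a = 0 then coeff d f else 0
    have hg (d) : coeff d g = if d a = 0 then coeff d f else 0 := rfl
    have hmono : Ideal.span ((X : σ → MvPowerSeries σ K) '' s) ≤
        Ideal.span ((X : σ → MvPowerSeries σ K) '' ↑(insert a s)) :=
      Ideal.span_mono (Set.image_mono (by simp))
    have h1 : g ∈ Ideal.span ((X : σ → MvPowerSeries σ K) '' s) * 𝔞 := by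
      refine ih g (fun d hd => ?_) (fun d hd => ?_)
      · rw [hg]
        split_ifs with h
        · exact hs d (by simpa [h] using hd)
        · rfl
      · rw [hg, hN d hd, ite_self]
    obtain ⟨q, hq⟩ : X a ∣ f - g := by
      rw [X_dvd_iff]
      intro d hd
      simp [hg, hd]
    have h2 : f - g ∈ Ideal.span ((X : σ → MvPowerSeries σ K) '' ↑(insert a s)) * 𝔞 := by
      rw [hq]
      refine Ideal.mul_mem_mul (Ideal.subset_span ⟨a, by simp, rfl⟩) (h𝔞 q fun d hd => ?_)
      have := congrArg (coeff (Finsupp.single a 1 + d)) hq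
      rw [X, coeff_add_monomial_mul, one_mul] at this
      rw [← this, map_sub, hg, hN, ite_self, sub_zero]
      simp only [map_add, Finsupp.degree_single]
      lia
    simpa using add_mem h2 (Ideal.mul_mono_left hmono h1)

theorem mem_span_X_image_of_coeff_eq_zero (s : Finset σ) (f : MvPowerSeries σ K)
    (hs : ∀ d, (∀ a ∈ s, d a = 0) → coeff d f = 0) :
    f ∈ Ideal.span ((X : σ → MvPowerSeries σ K) '' s) := by
  have h0 : ∀ d : σ →₀ ℕ, d.degree ≤ 0 → coeff d f = 0 := fun d hd => by
    have : d = 0 := (Finsupp.degree_eq_zero_iff d).mp (Nat.le_zero.mp hd)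
    exact hs d (by simp [this])
  have := mem_span_X_image_mul_of_coeff_eq_zero (N := 0) (𝔞 := ⊤)
    (fun _ _ => Submodule.mem_top) s f hs h0
  rwa [Ideal.mul_top] at this

theorem mem_maximalIdeal_pow_of_coeff_eq_zero [Finite σ] (N : ℕ) (f : MvPowerSeries σ K)
    (h : ∀ d, d.degree < N → coeff d f = 0) :
    f ∈ IsLocalRing.maximalIdeal (MvPowerSeries σ K) ^ N := by
  have := Fintype.ofFinite σ
  induction N generalizing f with
  | zero => simp
  | succ N ih =>
    rw [pow_succ']
    refine Ideal.mul_mono_left ?_ (mem_span_X_image_mul_of_coeff_eq_zero ih Finset.univ f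
      (fun d hd => h d ?_) fun d hd => h d (by lia))
    · rw [Ideal.span_le]
      rintro _ ⟨i, -, rfl⟩
      simp [IsLocalRing.mem_maximalIdeal, MvPowerSeries.isUnit_iff_constantCoeff]
    · have : d = 0 := by
        ext a
        simpa using hd a
      simp [this]

/-- Ideals of a power series ring in finitely many variables are closed. -/
theorem mem_of_forall_exists_coeff_eq [Finite σ] (J : Ideal (MvPowerSeries σ K))
    (f : MvPowerSeries σ K)
    (h : ∀ N : ℕ, ∃ g ∈ J, ∀ d, d.degree < N → coeff d f = coeff d g) : f ∈ J := by
  by_cases hJ : J = ⊤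
  · simp [hJ]
  have := Ideal.Quotient.nontrivial_iff.mpr hJ
  have := IsLocalRing.of_surjective' (Ideal.Quotient.mk J) Ideal.Quotient.mk_surjective
  rw [← Ideal.Quotient.eq_zero_iff_mem, ← Ideal.mem_bot,
    ← Ideal.iInf_pow_eq_bot_of_isLocalRing
      (IsLocalRing.maximalIdeal (MvPowerSeries σ K ⧸ J)) (Ideal.IsPrime.ne_top'),
    Ideal.mem_iInf]
  intro N
  obtain ⟨g, hg, hfg⟩ := h N
  have h1 := mem_maximalIdeal_pow_of_coeff_eq_zero N (f - g) fun d hd => by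
    rw [map_sub, hfg d hd, sub_self]
  have h2 := Ideal.mem_map_of_mem (Ideal.Quotient.mk J) h1
  rw [Ideal.map_pow, map_sub, Ideal.Quotient.eq_zero_iff_mem.mpr hg, sub_zero] at h2
  refine Ideal.pow_right_mono ?_ N h2
  rw [Ideal.map_le_iff_le_comap]
  exact (IsLocalRing.eq_maximalIdeal
    (Ideal.comap_isMaximal_of_surjective _ Ideal.Quotient.mk_surjective)).ge

theorem ringKrullDim_mvPowerSeries_fin (K : Type*) [Field K] (m : ℕ) :
    ringKrullDim (MvPowerSeries (Fin m) K) = m := by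
  induction m with
  | zero =>
    rw [ringKrullDim_eq_of_ringEquiv (isEmptyEquiv (Fin 0) K).toRingEquiv]
    simp
  | succ m ih =>
    rw [ringKrullDim_eq_of_ringEquiv (finSuccEquiv K m).toRingEquiv]
    let A := MvPowerSeries (Fin m) K
    have : IsLocalRing (PowerSeries A) := inferInstanceAs (IsLocalRing (MvPowerSeries Unit A))
    have hX : (PowerSeries.X : PowerSeries A) ∈ nonZeroDivisors (PowerSeries A) :=
      MvPowerSeries.X_mem_nonzeroDivisors
    have hm : (PowerSeries.X : PowerSeries A) ∈ IsLocalRing.maximalIdeal (PowerSeries A) := by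
      rw [IsLocalRing.mem_maximalIdeal, mem_nonunits_iff, PowerSeries.isUnit_iff_constantCoeff]
      simp
    rw [← ringKrullDim_quotient_span_singleton_succ_eq_ringKrullDim_of_mem_nonZeroDivisors hX hm]
    have hk : Ideal.span {(PowerSeries.X : PowerSeries A)} =
        RingHom.ker (PowerSeries.constantCoeff (R := A)) := by
      ext f
      rw [Ideal.mem_span_singleton, PowerSeries.X_dvd_iff, RingHom.mem_ker]
    rw [ringKrullDim_eq_of_ringEquiv ((Ideal.quotEquivOfEq hk).trans
      (RingHom.quotientKerEquivOfSurjective fun a => ⟨PowerSeries.C a, by simp⟩)), ih]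
    simp

end PowerSeriesIdeals

section ToricMap

variable {m n}

/-- The total exponent of the row variables. -/
def rowDeg {ι κ : Type*} [Fintype ι] : ((ι ⊕ κ) →₀ ℕ) →+ ℕ where
  toFun μ := ∑ i, μ (Sum.inl i)
  map_zero' := by simp
  map_add' := by simp [Finset.sum_add_distrib]

/-- The total exponent of the column variables. -/
def colDeg {ι κ : Type*} [Fintype κ] : ((ι ⊕ κ) →₀ ℕ) →+ ℕ where
  toFun μ := ∑ j, μ (Sum.inr j)
  map_zero' := by simp
  map_add' := by simp [Finset.sum_add_distrib]

theorem rowDeg_apply {ι κ : Type*} [Fintype ι] (μ : (ι ⊕ κ) →₀ ℕ) :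
    rowDeg μ = ∑ i, μ (Sum.inl i) := rfl

theorem colDeg_apply {ι κ : Type*} [Fintype κ] (μ : (ι ⊕ κ) →₀ ℕ) :
    colDeg μ = ∑ j, μ (Sum.inr j) := rfl

@[simp]
theorem rowDeg_single_inl {ι κ : Type*} [Fintype ι] (i : ι) (a : ℕ) :
    rowDeg (Finsupp.single (Sum.inl i : ι ⊕ κ) a) = a := by
  classical
  simp [rowDeg_apply, Finsupp.single_apply]

@[simp]
theorem rowDeg_single_inr {ι κ : Type*} [Fintype ι] (j : κ) (a : ℕ) :
    rowDeg (Finsupp.single (Sum.inr j : ι ⊕ κ) a) = 0 := by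
  classical
  simp [rowDeg_apply]

@[simp]
theorem colDeg_single_inl {ι κ : Type*} [Fintype κ] (i : ι) (a : ℕ) :
    colDeg (Finsupp.single (Sum.inl i : ι ⊕ κ) a) = 0 := by
  classical
  simp [colDeg_apply]

@[simp]
theorem colDeg_single_inr {ι κ : Type*} [Fintype κ] (j : κ) (a : ℕ) :
    colDeg (Finsupp.single (Sum.inr j : ι ⊕ κ) a) = a := by
  classical
  simp [colDeg_apply, Finsupp.single_apply]

/-- The exponent vector of the image of `x_{ij}` in `S`. -/
def detExp (s : Fin m × Fin n) : (Fin m ⊕ Fin (n - 1)) →₀ ℕ :=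
  Finsupp.single (Sum.inl s.1) 1 +
    if h : (s.2 : ℕ) < n - 1 then Finsupp.single (Sum.inr ⟨s.2, h⟩) 1 else 0

/-- The exponent vector of the image of a monomial in `S`. -/
def detMarg : ((Fin m × Fin n) →₀ ℕ) →+ ((Fin m ⊕ Fin (n - 1)) →₀ ℕ) :=
  (Finsupp.linearCombination ℕ detExp).toAddMonoidHom

theorem detMarg_apply (d : (Fin m × Fin n) →₀ ℕ) : detMarg d = ∑ s, d s • detExp s := by
  change Finsupp.linearCombination ℕ detExp d = _
  rw [Finsupp.linearCombination_apply, Finsupp.sum_fintype _ _ (by simp)]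

@[simp]
theorem detMarg_single (s : Fin m × Fin n) (a : ℕ) :
    detMarg (Finsupp.single s a) = a • detExp s := by
  simp [detMarg]

theorem detMarg_inl (d : (Fin m × Fin n) →₀ ℕ) (i : Fin m) :
    detMarg d (Sum.inl i) = ∑ j, d (i, j) := by
  classical
  have (s : Fin m × Fin n) : detExp s (Sum.inl i) = if s.1 = i then 1 else 0 := by
    unfold detExp
    split_ifs with h1 h2 h2 <;> simp [h2]
  simp [detMarg_apply, Finsupp.finsetSum_apply, this, Fintype.sum_prod_type]

theorem detMarg_inr (d : (Fin m × Fin n) →₀ ℕ) (j : Fin (n - 1)) :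
    detMarg d (Sum.inr j) = ∑ i, d (i, ⟨j, by lia⟩) := by
  classical
  have (s : Fin m × Fin n) :
      detExp s (Sum.inr j) = if s.2 = ⟨j, by lia⟩ then 1 else 0 := by
    unfold detExp
    split_ifs with h1 h2 h2
    · simp [h2]
    · have : (⟨s.2, h1⟩ : Fin (n - 1)) ≠ j := fun h => h2 (by simp [← h])
      simp [this]
    · exact absurd j.2 (by rwa [h2] at h1)
    · simp
  simp [detMarg_apply, Finsupp.finsetSum_apply, this, Fintype.sum_prod_type]
  refine Finset.sum_congr rfl fun i _ => ?_
  rw [Finset.sum_eq_single ⟨j, by lia⟩] <;> simp +contextual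

theorem rowDeg_detMarg (d : (Fin m × Fin n) →₀ ℕ) : rowDeg (detMarg d) = d.degree := by
  simp [rowDeg_apply, detMarg_inl, Finsupp.degree_eq_sum, Fintype.sum_prod_type]

theorem colDeg_detExp_le (s : Fin m × Fin n) : colDeg (detExp s) ≤ 1 := by
  unfold detExp
  split_ifs <;> simp

theorem colDeg_detMarg_le (d : (Fin m × Fin n) →₀ ℕ) :
    colDeg (detMarg d) ≤ rowDeg (detMarg d) := by
  rw [rowDeg_detMarg, detMarg_apply, map_sum, Finsupp.degree_eq_sum]
  exact Finset.sum_le_sum fun s _ => by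
    simpa using Nat.mul_le_mul_left (d s) (colDeg_detExp_le s)

theorem sum_col_eq_of_detMarg_eq {d d' : (Fin m × Fin n) →₀ ℕ} (h : detMarg d = detMarg d')
    (j : Fin n) : ∑ i, d (i, j) = ∑ i, d' (i, j) := by
  have key (j : Fin n) (hj : (j : ℕ) < n - 1) : ∑ i, d (i, j) = ∑ i, d' (i, j) := by
    simpa [detMarg_inr] using DFunLike.congr_fun h (Sum.inr ⟨j, hj⟩)
  by_cases hj : (j : ℕ) < n - 1
  · exact key j hj
  have hdeg : d.degree = d'.degree := by rw [← rowDeg_detMarg, h, rowDeg_detMarg]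
  rw [Finsupp.degree_eq_sum, Finsupp.degree_eq_sum, Fintype.sum_prod_type_right,
    Fintype.sum_prod_type_right, ← Finset.add_sum_erase _ _ (Finset.mem_univ j),
    ← Finset.add_sum_erase _ (fun j => ∑ i, d' (i, j)) (Finset.mem_univ j)] at hdeg
  have : ∑ x ∈ Finset.univ.erase j, ∑ i, d (i, x) =
      ∑ x ∈ Finset.univ.erase j, ∑ i, d' (i, x) :=
    Finset.sum_congr rfl fun x hx => key x <| by
      have h1 := Finset.ne_of_mem_erase hx
      have : (x : ℕ) ≠ j := fun h => h1 (Fin.ext h)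
      lia
  lia

theorem exists_detMarg_eq (hn : 1 ≤ n) (μ : (Fin m ⊕ Fin (n - 1)) →₀ ℕ)
    (hμ : colDeg μ ≤ rowDeg μ) : ∃ d : (Fin m × Fin n) →₀ ℕ, detMarg d = μ := by
  induction h : rowDeg μ generalizing μ with
  | zero =>
    refine ⟨0, ?_⟩
    rw [h, Nat.le_zero, colDeg_apply] at hμ
    rw [rowDeg_apply] at h
    ext (i | j)
    · simpa using ((Finset.sum_eq_zero_iff.mp h) i (Finset.mem_univ i)).symm
    · simpa using ((Finset.sum_eq_zero_iff.mp hμ) j (Finset.mem_univ j)).symm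
  | succ N ih =>
    obtain ⟨i, -, hi⟩ : ∃ i ∈ Finset.univ, μ (Sum.inl i) ≠ 0 :=
      Finset.exists_ne_zero_of_sum_ne_zero (by rw [← rowDeg_apply, h]; lia)
    obtain ⟨s, ν, hs, hν⟩ : ∃ (s : Fin m × Fin n) (ν : (Fin m ⊕ Fin (n - 1)) →₀ ℕ),
        μ = detExp s + ν ∧ colDeg ν ≤ rowDeg ν := by
      by_cases hc : colDeg μ = 0
      · have hle : Finsupp.single (Sum.inl i) 1 ≤ μ := by
          rw [Finsupp.single_le_iff]; lia
        obtain ⟨ν, hν⟩ := exists_add_of_le hle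
        refine ⟨(i, ⟨n - 1, by lia⟩), ν, by simpa [detExp] using hν, ?_⟩
        rw [hν, map_add] at hc
        lia
      · obtain ⟨j, -, hj⟩ : ∃ j ∈ Finset.univ, μ (Sum.inr j) ≠ 0 :=
          Finset.exists_ne_zero_of_sum_ne_zero hc
        have hle : Finsupp.single (Sum.inl i) 1 + Finsupp.single (Sum.inr j) 1 ≤ μ := by
          classical
          intro x
          simp only [Finsupp.add_apply, Finsupp.single_apply]
          split_ifs with h1 h2 h2
          · simp [← h1] at h2
          · rw [← h1]; lia
          · rw [← h2]; lia
          · lia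
        obtain ⟨ν, hν⟩ := exists_add_of_le hle
        refine ⟨(i, ⟨j, by lia⟩), ν, by simpa [detExp] using hν, ?_⟩
        have h1 := congrArg rowDeg hν
        have h2 := congrArg colDeg hν
        simp only [map_add, rowDeg_single_inl, rowDeg_single_inr, colDeg_single_inl,
          colDeg_single_inr] at h1 h2
        lia
    have h1 : rowDeg (detExp s) = 1 := by
      have := rowDeg_detMarg (Finsupp.single s 1)
      simpa using this
    obtain ⟨d, hd⟩ := ih ν hν (by rw [hs, map_add, h1] at h; lia)
    exact ⟨Finsupp.single s 1 + d, by simp [hd, hs]⟩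

theorem minor_mem_detI2 (i k : Fin m) (j l : Fin n) :
    (X (i, j) * X (k, l) - X (i, l) * X (k, j) : DetP 𝕜 m n) ∈ detI2 𝕜 m n := by
  have key (i k : Fin m) (j l : Fin n) (h : i < k) :
      (X (i, j) * X (k, l) - X (i, l) * X (k, j) : DetP 𝕜 m n) ∈ detI2 𝕜 m n := by
    rcases lt_trichotomy j l with h' | rfl | h'
    · exact Ideal.subset_span ⟨i, k, j, l, h, h', rfl⟩
    · simp
    · rw [← neg_mem_iff, neg_sub]
      exact Ideal.subset_span ⟨i, k, l, j, h, h', rfl⟩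
  rcases lt_trichotomy i k with h | rfl | h
  · exact key i k j l h
  · rw [mul_comm, sub_self]
    exact zero_mem _
  · have := key k i l j h
    rwa [mul_comm, mul_comm (X (k, j))] at this

theorem monomial_sub_monomial_mem_detI2 (d d' : (Fin m × Fin n) →₀ ℕ)
    (h : detMarg d = detMarg d') :
    (monomial d 1 - monomial d' 1 : DetP 𝕜 m n) ∈ detI2 𝕜 m n := by
  induction hN : d.degree generalizing d d' with
  | zero =>
    have hN' : d'.degree = 0 := by rw [← rowDeg_detMarg, ← h, rowDeg_detMarg, hN]
    rw [Finsupp.degree_eq_zero_iff] at hN hN'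
    simp [hN, hN']
  | succ N ih =>
    obtain ⟨⟨i, j⟩, hs⟩ : ∃ s, d s ≠ 0 := by
      by_contra! hd
      simp [Finsupp.degree_eq_sum, hd] at hN
    obtain ⟨l, -, hl⟩ : ∃ l ∈ Finset.univ, d' (i, l) ≠ 0 :=
      Finset.exists_ne_zero_of_sum_ne_zero <| by
        rw [← detMarg_inl, ← h, detMarg_inl]
        exact fun h0 => hs (Finset.sum_eq_zero_iff.mp h0 j (Finset.mem_univ j))
    obtain ⟨k, -, hk⟩ : ∃ k ∈ Finset.univ, d' (k, j) ≠ 0 :=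
      Finset.exists_ne_zero_of_sum_ne_zero <| by
        rw [← sum_col_eq_of_detMarg_eq h]
        exact fun h0 => hs (Finset.sum_eq_zero_iff.mp h0 i (Finset.mem_univ i))
    obtain ⟨e, he, hed⟩ : ∃ e, detMarg (Finsupp.single (i, j) 1 + e) = detMarg d' ∧
        (monomial (Finsupp.single (i, j) 1 + e) 1 - monomial d' 1 : DetP 𝕜 m n) ∈
          detI2 𝕜 m n := by
      by_cases h0 : d' (i, j) = 0
      · have hik : i ≠ k := by rintro rfl; exact hk h0
        have hle : Finsupp.single (i, l) 1 + Finsupp.single (k, j) 1 ≤ d' := by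
          classical
          intro x
          simp only [Finsupp.add_apply, Finsupp.single_apply]
          split_ifs with h1 h2 h2
          · rw [← h1] at h2
            exact absurd (congrArg Prod.fst h2).symm hik
          · rw [← h1]; lia
          · rw [← h2]; lia
          · lia
        obtain ⟨ν, hν⟩ := exists_add_of_le hle
        refine ⟨Finsupp.single (k, l) 1 + ν, ?_, ?_⟩
        · rw [hν]
          simp only [map_add, detMarg_single, one_smul, detExp]
          abel
        · have h1 := Ideal.mul_mem_right (monomial ν 1) _ (minor_mem_detI2 𝕜 i k j l)
          rw [hν]
          rw [sub_mul] at h1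
          simpa only [X, monomial_mul_monomial, one_mul, add_assoc] using h1
      · have hle : Finsupp.single (i, j) 1 ≤ d' := by
          rw [Finsupp.single_le_iff]; lia
        obtain ⟨ν, hν⟩ := exists_add_of_le hle
        exact ⟨ν, by rw [hν], by rw [hν, sub_self]; exact zero_mem _⟩
    have hle : Finsupp.single (i, j) 1 ≤ d := by
      rw [Finsupp.single_le_iff]; lia
    obtain ⟨ν, rfl⟩ := exists_add_of_le hle
    have h1 := ih ν e (by simpa [← he] using h) (by
      simp only [map_add, Finsupp.degree_single] at hN
      lia)
    have h2 := Ideal.mul_mem_left _ (monomial (Finsupp.single (i, j) 1) 1) h1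
    rw [mul_sub, monomial_mul_monomial, monomial_mul_monomial, one_mul] at h2
    simpa using add_mem h2 hed

theorem detExp_hasSubst :
    HasSubst (fun s : Fin m × Fin n => (monomial (detExp s) 1 : DetS 𝕜 m n)) := by
  classical
  refine hasSubst_of_constantCoeff_zero fun s => ?_
  rw [← coeff_zero_eq_constantCoeff_apply, coeff_monomial, if_neg]
  intro h
  have h3 := rowDeg_detMarg (Finsupp.single s 1)
  simp [← h] at h3

/-- The map `P → S` with kernel `I₂(X)`. -/
def toricMap : DetP 𝕜 m n →ₐ[𝕜] DetS 𝕜 m n := substAlgHom (detExp_hasSubst 𝕜)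

@[simp]
theorem toricMap_X (s : Fin m × Fin n) : toricMap 𝕜 (X s) = monomial (detExp s) 1 :=
  substAlgHom_X _ _

open Classical in
theorem coeff_toricMap (f : DetP 𝕜 m n) (e : (Fin m ⊕ Fin (n - 1)) →₀ ℕ) :
    coeff e (toricMap 𝕜 f) = ∑ᶠ d, if detMarg d = e then coeff d f else 0 := by
  rw [toricMap, substAlgHom_apply, coeff_subst (detExp_hasSubst 𝕜)]
  congr! 2 with d
  have : (d.prod fun s a => (monomial (detExp s) 1 : DetS 𝕜 m n) ^ a) =
      monomial (detMarg d) 1 := by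
    simp_rw [monomial_pow, one_pow]
    rw [Finsupp.prod_fintype _ _ (by simp), prod_monomial, detMarg_apply]
    simp
  rw [this, coeff_monomial]
  simp [eq_comm]

theorem degree_eq_of_detMarg_eq {d : (Fin m × Fin n) →₀ ℕ} {e} (h : detMarg d = e) :
    d.degree = rowDeg e := by
  rw [← h, rowDeg_detMarg]

theorem ker_toricMap : RingHom.ker (toricMap 𝕜 (m := m) (n := n)) = detI2 𝕜 m n := by
  classical
  apply le_antisymm
  · intro f hf
    rw [RingHom.mem_ker] at hf
    refine mem_of_forall_exists_coeff_eq _ f fun N => ?_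
    have hfin : {d : (Fin m × Fin n) →₀ ℕ | d.degree < N}.Finite :=
      (Finsupp.finite_of_degree_le N).subset fun d hd => (Set.mem_ofPred.mp hd).le
    let S := hfin.toFinset
    have hS (d) : d ∈ S ↔ d.degree < N := by simp [S]
    let r : ((Fin m ⊕ Fin (n - 1)) →₀ ℕ) → ((Fin m × Fin n) →₀ ℕ) := Function.invFun detMarg
    have hr (d) : detMarg (r (detMarg d)) = detMarg (m := m) (n := n) d :=
      Function.invFun_eq ⟨d, rfl⟩
    refine ⟨∑ d ∈ S, monomial d (coeff d f), ?_, fun d hd => ?_⟩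
    · have h1 : ∑ d ∈ S, monomial d (coeff d f) =
          ∑ d ∈ S, monomial 0 (coeff d f) * (monomial d 1 - monomial (r (detMarg d)) 1) +
          ∑ d ∈ S, monomial (r (detMarg d)) (coeff d f) := by
        rw [← Finset.sum_add_distrib]
        refine Finset.sum_congr rfl fun d _ => ?_
        rw [mul_sub, monomial_mul_monomial, monomial_mul_monomial, zero_add, zero_add, mul_one,
          sub_add_cancel]
      have h2 : ∑ d ∈ S, monomial (r (detMarg d)) (coeff d f) = 0 := by
        rw [← Finset.sum_fiberwise_of_maps_to (t := S.image detMarg)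
          (fun d hd => Finset.mem_image_of_mem _ hd)]
        refine Finset.sum_eq_zero fun e he => ?_
        obtain ⟨d₀, hd₀, rfl⟩ := Finset.mem_image.mp he
        have h3 : ∑ d ∈ S with detMarg d = detMarg d₀, coeff d f = 0 := by
          have := coeff_toricMap 𝕜 f (detMarg d₀)
          rw [hf, map_zero] at this
          rw [this, Finset.sum_filter, finsum_eq_sum_of_support_subset]
          intro d hd
          have : detMarg d = detMarg d₀ := by
            by_contra h
            simp [h] at hd
          rw [Finset.mem_coe, hS, degree_eq_of_detMarg_eq this, rowDeg_detMarg]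
          exact (hS _).mp hd₀
        calc _ = ∑ d ∈ S with detMarg d = detMarg d₀,
              monomial (r (detMarg d₀)) (coeff d f) :=
            Finset.sum_congr rfl fun d hd => by rw [(Finset.mem_filter.mp hd).2]
          _ = 0 := by rw [← map_sum, h3, map_zero]
      rw [h1, h2, add_zero]
      exact sum_mem fun d _ => Ideal.mul_mem_left _ _
        (monomial_sub_monomial_mem_detI2 𝕜 _ _ (hr d).symm)
    · simp only [map_sum, coeff_monomial]
      rw [Finset.sum_ite_eq S d, if_pos ((hS d).mpr hd)]
  · rw [detI2, Ideal.span_le]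
    rintro _ ⟨i, k, j, l, -, -, rfl⟩
    simp only [SetLike.mem_coe, RingHom.mem_ker, map_sub, map_mul, toricMap_X,
      monomial_mul_monomial, detExp]
    rw [sub_eq_zero]
    congr 2
    abel

theorem mem_range_toricMap (hn : 1 ≤ n) (g : DetS 𝕜 m n) :
    g ∈ (toricMap 𝕜 (m := m) (n := n)).range ↔
      ∀ μ, coeff μ g ≠ 0 → colDeg μ ≤ rowDeg μ := by
  classical
  constructor
  · rintro ⟨f, rfl⟩ μ hμ
    have h1 : coeff μ (toricMap 𝕜 f) ≠ 0 := hμ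
    rw [coeff_toricMap] at h1
    obtain ⟨d, rfl⟩ : ∃ d, detMarg d = μ := by
      by_contra! h
      simp [h] at h1
    exact colDeg_detMarg_le d
  · intro h
    let r : ((Fin m ⊕ Fin (n - 1)) →₀ ℕ) → ((Fin m × Fin n) →₀ ℕ) := Function.invFun detMarg
    let f : DetP 𝕜 m n := fun d => if d = r (detMarg d) then coeff (detMarg d) g else 0
    have hf (d) : coeff d f = if d = r (detMarg d) then coeff (detMarg d) g else 0 := rfl
    refine ⟨f, ?_⟩
    ext μ
    change coeff μ (toricMap 𝕜 f) = _
    rw [coeff_toricMap]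
    by_cases hμ : coeff μ g = 0
    · rw [hμ]
      refine finsum_eq_zero_of_forall_eq_zero fun d => ?_
      split_ifs with hd
      · rw [hf, hd, hμ, ite_self]
      · rfl
    · have hr : detMarg (r μ) = μ := Function.invFun_eq (exists_detMarg_eq hn μ (h μ hμ))
      rw [finsum_eq_single _ (r μ), if_pos hr, hf, hr, if_pos rfl]
      intro d hd
      split_ifs with h1
      · rw [hf, h1, if_neg hd]
      · rfl

end ToricMap

section RegularPairs

variable {S : Type*} [CommRing S]

/-- `rs` is a weakly regular sequence on `M / (M ∩ N)`, for additive subgroups `N`, `M` of a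
ring `S` whose elements contain `rs`. -/
def RegPair (N M : AddSubgroup S) : List S → Prop
  | [] => True
  | r :: rs => (∀ x ∈ M, r * x ∈ N → x ∈ N) ∧
      RegPair (N ⊔ M.map (AddMonoidHom.mulLeft r)) M rs

theorem mem_sup_map_mulLeft {N M : AddSubgroup S} {r x : S} :
    x ∈ N ⊔ M.map (AddMonoidHom.mulLeft r) ↔ ∃ y ∈ N, ∃ z ∈ M, y + r * z = x := by
  simp [AddSubgroup.mem_sup]

theorem RegPair.of_le {N M : AddSubgroup S} (h : M ≤ N) (rs : List S) : RegPair N M rs := by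
  induction rs generalizing N with
  | nil => trivial
  | cons r rs ih => exact ⟨fun x hx _ => h hx, ih (h.trans le_sup_left)⟩

theorem RegPair.of_exact {N N' N'' M M' : AddSubgroup S} (a : S) (rs : List S)
    (hN : ∀ r ∈ rs, ∀ x ∈ N, r * x ∈ N) (hM : ∀ r ∈ rs, ∀ x ∈ M, r * x ∈ M)
    (hM' : ∀ r ∈ rs, ∀ x ∈ M', r * x ∈ M')
    (ha : ∀ y ∈ M', a * y ∈ M) (haN : ∀ y ∈ N', a * y ∈ N)
    (hinj : ∀ y ∈ M', a * y ∈ N → y ∈ N')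
    (hex : ∀ x, x ∈ N'' ↔ ∃ y ∈ N, ∃ z ∈ M', y + a * z = x)
    (h' : RegPair N' M' rs) (h'' : RegPair N'' M rs) : RegPair N M rs := by
  induction rs generalizing N N' N'' with
  | nil => trivial
  | cons r rs ih =>
    have hr : r ∈ r :: rs := by simp
    have hle : ∀ x ∈ N, x ∈ N'' := fun x hx => (hex x).mpr ⟨x, hx, 0, zero_mem _, by simp⟩
    refine ⟨fun x hx hrx => ?_, ih (N := N ⊔ _) (N' := N' ⊔ _) (N'' := N'' ⊔ _)
      ?_ (fun s hs => hM s (by simp [hs])) (fun s hs => hM' s (by simp [hs])) ?_ ?_ ?_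
      h'.2 h''.2⟩
    · obtain ⟨y, hy, z, hz, rfl⟩ := (hex x).mp (h''.1 x hx (hle _ hrx))
      refine add_mem hy (haN z (h'.1 z hz (hinj _ (hM' r hr z hz) ?_)))
      have : a * (r * z) = r * (y + a * z) - r * y := by ring
      rw [this]
      exact sub_mem hrx (hN r hr y hy)
    · intro s hs x hx
      obtain ⟨y, hy, z, hz, rfl⟩ := mem_sup_map_mulLeft.mp hx
      exact mem_sup_map_mulLeft.mpr ⟨s * y, hN s (by simp [hs]) y hy, s * z,
        hM s (by simp [hs]) z hz, by ring⟩
    · intro x hx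
      obtain ⟨y, hy, z, hz, rfl⟩ := mem_sup_map_mulLeft.mp hx
      exact mem_sup_map_mulLeft.mpr ⟨a * y, haN y hy, a * z, ha z hz, by ring⟩
    · intro y hy hay
      obtain ⟨u, hu, x, hx, hux⟩ := mem_sup_map_mulLeft.mp hay
      have h1 : r * x ∈ N'' := (hex _).mpr ⟨-u, neg_mem hu, y, hy, by rw [← hux]; ring⟩
      obtain ⟨v, hv, z, hz, rfl⟩ := (hex x).mp (h''.1 x hx h1)
      refine mem_sup_map_mulLeft.mpr ⟨y - r * z,
        hinj _ (sub_mem hy (hM' r hr z hz)) ?_, z, hz, by ring⟩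
      have : a * (y - r * z) = u + r * v := by linear_combination -hux
      rw [this]
      exact add_mem hu (hN r hr v hv)
    · intro x
      rw [mem_sup_map_mulLeft]
      constructor
      · rintro ⟨y, hy, z, hz, rfl⟩
        obtain ⟨u, hu, w, hw, rfl⟩ := (hex y).mp hy
        exact ⟨u + r * z, mem_sup_map_mulLeft.mpr ⟨u, hu, z, hz, rfl⟩, w, hw, by ring⟩
      · rintro ⟨y, hy, w, hw, rfl⟩
        obtain ⟨u, hu, z, hz, rfl⟩ := mem_sup_map_mulLeft.mp hy
        exact ⟨u + a * w, (hex _).mpr ⟨u, hu, w, hw, rfl⟩, z, hz, by ring⟩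

theorem RegPair.mem_of_mul_mem {R : Type*} [CommRing R] (φ : R →+* S)
    (hφ : Function.Injective φ) (I : Ideal R) (rs : List R)
    (h : RegPair (I.toAddSubgroup.map φ.toAddMonoidHom) φ.toAddMonoidHom.range (rs.map φ))
    (i : ℕ) (hi : i < rs.length) (x : R) (hx : rs[i] * x ∈ I ⊔ Ideal.ofList (rs.take i)) :
    x ∈ I ⊔ Ideal.ofList (rs.take i) := by
  induction rs generalizing I i with
  | nil => simp at hi
  | cons r rs ih =>
    cases i with
    | zero =>
      simp only [List.getElem_cons_zero, List.take_zero, Ideal.ofList_nil, sup_bot_eq] at hx ⊢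
      obtain ⟨y, hy, hyx⟩ := h.1 (φ x) ⟨x, rfl⟩ ⟨r * x, hx, by simp⟩
      rwa [← hφ hyx]
    | succ i =>
      simp only [List.getElem_cons_succ, List.take_succ_cons, Ideal.ofList_cons,
        ← sup_assoc] at hx ⊢
      refine ih (I ⊔ Ideal.span {r}) ?_ i (by simpa using hi) hx
      convert h.2 using 1
      ext z
      rw [mem_sup_map_mulLeft]
      constructor
      · rintro ⟨y, hy, rfl⟩
        obtain ⟨u, hu, v, hv, rfl⟩ := Submodule.mem_sup.mp hy
        obtain ⟨w, rfl⟩ := Ideal.mem_span_singleton'.mp hv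
        exact ⟨φ u, ⟨u, hu, rfl⟩, φ w, ⟨w, rfl⟩, by simp [mul_comm]⟩
      · rintro ⟨_, ⟨u, hu, rfl⟩, _, ⟨w, rfl⟩, rfl⟩
        exact ⟨u + r * w, add_mem (Ideal.mem_sup_left hu)
          (Ideal.mem_sup_right (Ideal.mul_mem_right w _ (Ideal.mem_span_singleton_self r))),
          by simp⟩

theorem RegPair.isWeaklyRegular {R : Type*} [CommRing R] (φ : R →+* S)
    (hφ : Function.Injective φ) (rs : List R)
    (h : RegPair ⊥ φ.toAddMonoidHom.range (rs.map φ)) :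
    RingTheory.Sequence.IsWeaklyRegular R rs := by
  refine ⟨fun i hi => ?_⟩
  rw [isSMulRegular_iff_right_eq_zero_of_smul]
  intro y hy
  obtain ⟨x, rfl⟩ := Submodule.Quotient.mk_surjective _ y
  rw [← Submodule.Quotient.mk_smul, Submodule.Quotient.mk_eq_zero] at hy
  rw [Submodule.Quotient.mk_eq_zero]
  have key := RegPair.mem_of_mul_mem φ hφ ⊥ rs (by
    convert h using 1
    ext z
    simp) i hi x
  simpa [Ideal.mul_top] using key (by simpa [Ideal.mul_top] using hy)

end RegularPairs

section SegreSequence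

variable {K : Type*} [Field K] {m c : ℕ}

/-- Power series all of whose monomials have column degree at most the row degree minus `f`. -/
def weightSubgroup (K : Type*) [Field K] (m c : ℕ) (f : ℤ) :
    AddSubgroup (MvPowerSeries (Fin m ⊕ Fin c) K) where
  carrier := {g | ∀ μ, coeff μ g ≠ 0 → (colDeg μ : ℤ) + f ≤ rowDeg μ}
  zero_mem' := by simp
  add_mem' := by
    intro a b ha hb μ hμ
    by_cases h : coeff μ a = 0
    · exact hb μ (by simpa [h] using hμ)
    · exact ha μ h
  neg_mem' := by
    intro a ha μ hμ
    exact ha μ (by simpa using hμ)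

theorem mem_weightSubgroup {f : ℤ} {g : MvPowerSeries (Fin m ⊕ Fin c) K} :
    g ∈ weightSubgroup K m c f ↔ ∀ μ, coeff μ g ≠ 0 → (colDeg μ : ℤ) + f ≤ rowDeg μ :=
  Iff.rfl

theorem mul_mem_weightSubgroup {f f' f'' : ℤ} {g g' : MvPowerSeries (Fin m ⊕ Fin c) K}
    (hg : g ∈ weightSubgroup K m c f) (hg' : g' ∈ weightSubgroup K m c f')
    (hf : f + f' = f'') : g * g' ∈ weightSubgroup K m c f'' := by
  classical
  intro μ hμ
  rw [coeff_mul] at hμ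
  obtain ⟨⟨a, b⟩, hab, h⟩ := Finset.exists_ne_zero_of_sum_ne_zero hμ
  rw [Finset.HasAntidiagonal.mem_antidiagonal] at hab
  have h1 := hg a (left_ne_zero_of_mul h)
  have h2 := hg' b (right_ne_zero_of_mul h)
  simp only [← hab, map_add]
  push_cast
  lia

theorem X_inl_mem_weightSubgroup (i : Fin m) :
    (X (Sum.inl i) : MvPowerSeries (Fin m ⊕ Fin c) K) ∈ weightSubgroup K m c 1 := by
  classical
  intro μ hμ
  have : μ = Finsupp.single (Sum.inl i) 1 := by
    by_contra h
    simp [coeff_X, h] at hμ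
  simp [this]

theorem X_inr_mem_weightSubgroup (j : Fin c) :
    (X (Sum.inr j) : MvPowerSeries (Fin m ⊕ Fin c) K) ∈ weightSubgroup K m c (-1) := by
  classical
  intro μ hμ
  have : μ = Finsupp.single (Sum.inr j) 1 := by
    by_contra h
    simp [coeff_X, h] at hμ
  simp [this]

/-- The ideal generated by the first `p` row variables and the first `q` column variables,
described through coefficients. -/
def initialIdeal (K : Type*) [Field K] (m c p q : ℕ) :
    Ideal (MvPowerSeries (Fin m ⊕ Fin c) K) where
  carrier := {g | ∀ μ : (Fin m ⊕ Fin c) →₀ ℕ, (∀ i : Fin m, (i : ℕ) < p → μ (Sum.inl i) = 0) →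
    (∀ j : Fin c, (j : ℕ) < q → μ (Sum.inr j) = 0) → coeff μ g = 0}
  zero_mem' := by simp
  add_mem' := by
    intro a b ha hb μ h1 h2
    rw [map_add, ha μ h1 h2, hb μ h1 h2, add_zero]
  smul_mem' := by
    classical
    intro a b hb μ h1 h2
    rw [smul_eq_mul, coeff_mul]
    refine Finset.sum_eq_zero fun x hx => ?_
    rw [Finset.HasAntidiagonal.mem_antidiagonal] at hx
    rw [hb x.2, mul_zero]
    · intro i hi
      have := h1 i hi
      rw [← hx, Finsupp.add_apply] at this
      lia
    · intro j hj
      have := h2 j hj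
      rw [← hx, Finsupp.add_apply] at this
      lia

theorem mem_initialIdeal {p q : ℕ} {g : MvPowerSeries (Fin m ⊕ Fin c) K} :
    g ∈ initialIdeal K m c p q ↔ ∀ μ : (Fin m ⊕ Fin c) →₀ ℕ,
      (∀ i : Fin m, (i : ℕ) < p → μ (Sum.inl i) = 0) →
      (∀ j : Fin c, (j : ℕ) < q → μ (Sum.inr j) = 0) → coeff μ g = 0 :=
  Iff.rfl

theorem X_inl_mem_initialIdeal {p q : ℕ} (i : Fin m) (hi : (i : ℕ) < p) :
    (X (Sum.inl i) : MvPowerSeries (Fin m ⊕ Fin c) K) ∈ initialIdeal K m c p q := by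
  classical
  intro μ h1 _
  rw [coeff_X, if_neg]
  rintro rfl
  simpa using h1 i hi

theorem X_inr_mem_initialIdeal {p q : ℕ} (j : Fin c) (hj : (j : ℕ) < q) :
    (X (Sum.inr j) : MvPowerSeries (Fin m ⊕ Fin c) K) ∈ initialIdeal K m c p q := by
  classical
  intro μ _ h2
  rw [coeff_X, if_neg]
  rintro rfl
  simpa using h2 j hj

theorem initialIdeal_mono {p q p' q' : ℕ} (hp : p ≤ p') (hq : q ≤ q') :
    initialIdeal K m c p q ≤ initialIdeal K m c p' q' :=
  fun _ hg μ h1 h2 => hg μ (fun i hi => h1 i (hi.trans_le hp)) fun j hj => h2 j (hj.trans_le hq)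

/-- The sum of the products of row and column variables on an antidiagonal. -/
def antidiagSum (K : Type*) [Field K] (m c k : ℕ) : MvPowerSeries (Fin m ⊕ Fin c) K :=
  ∑ s : Fin m × Fin c, if (s.1 + s.2 : ℕ) = k then X (Sum.inl s.1) * X (Sum.inr s.2) else 0

theorem antidiagSum_mem (k : ℕ) : antidiagSum K m c k ∈ weightSubgroup K m c 0 := by
  refine sum_mem fun s _ => ?_
  split_ifs
  · exact mul_mem_weightSubgroup (X_inl_mem_weightSubgroup _) (X_inr_mem_weightSubgroup _)
      (by simp)
  · exact zero_mem _

theorem antidiagSum_sub_mem (p : Fin m) (q : Fin c) :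
    antidiagSum K m c (p + q) - X (Sum.inl p) * X (Sum.inr q) ∈ initialIdeal K m c p q := by
  classical
  rw [antidiagSum, ← Finset.add_sum_erase _ _ (Finset.mem_univ (p, q)), if_pos rfl,
    add_sub_cancel_left]
  refine sum_mem fun s hs => ?_
  split_ifs with h
  · by_cases h1 : (s.1 : ℕ) < p
    · exact Ideal.mul_mem_right _ _ (X_inl_mem_initialIdeal _ h1)
    · refine Ideal.mul_mem_left _ _ (X_inr_mem_initialIdeal _ ?_)
      by_contra h2
      refine Finset.ne_of_mem_erase hs (Prod.ext (Fin.ext ?_) (Fin.ext ?_)) <;> dsimp <;> lia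
  · exact zero_mem _

theorem exists_eq_add_X_mul_of_coeff {σ : Type*} (s : σ) (g : MvPowerSeries σ K) :
    ∃ u h : MvPowerSeries σ K, g = u + X s * h ∧
      (∀ μ, coeff μ h = coeff (Finsupp.single s 1 + μ) g) ∧
      ∀ μ, coeff μ u = if μ s = 0 then coeff μ g else 0 := by
  let u : MvPowerSeries σ K := fun μ => if μ s = 0 then coeff μ g else 0
  have hu (μ) : coeff μ u = if μ s = 0 then coeff μ g else 0 := rfl
  obtain ⟨h, hh⟩ : X s ∣ g - u := by
    rw [X_dvd_iff]
    intro μ hμ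
    simp [hu, hμ]
  refine ⟨u, h, by rw [← hh]; ring, fun μ => ?_, hu⟩
  have := congrArg (coeff (Finsupp.single s 1 + μ)) hh
  rw [X, coeff_add_monomial_mul, one_mul, map_sub, hu] at this
  simpa using this.symm

theorem coeff_single_add_X_mul {σ : Type*} (s : σ) (g : MvPowerSeries σ K) (μ : σ →₀ ℕ) :
    coeff (Finsupp.single s 1 + μ) (X s * g) = coeff μ g := by
  rw [X, coeff_add_monomial_mul, one_mul]

/-- The part of `initialIdeal` lying in `weightSubgroup`. -/
def initialSubgroup (K : Type*) [Field K] (m c p q : ℕ) (f : ℤ) :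
    AddSubgroup (MvPowerSeries (Fin m ⊕ Fin c) K) :=
  (initialIdeal K m c p q).toAddSubgroup ⊓ weightSubgroup K m c f

theorem mem_initialSubgroup {p q : ℕ} {f : ℤ} {g : MvPowerSeries (Fin m ⊕ Fin c) K} :
    g ∈ initialSubgroup K m c p q f ↔
      g ∈ initialIdeal K m c p q ∧ g ∈ weightSubgroup K m c f := Iff.rfl

theorem exists_eq_add_X_inl_mul {p : Fin m} {q : ℕ} {f : ℤ}
    {g : MvPowerSeries (Fin m ⊕ Fin c) K} (hg : g ∈ initialSubgroup K m c (p + 1) q (f + 1)) :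
    ∃ u ∈ initialSubgroup K m c p q (f + 1), ∃ h ∈ weightSubgroup K m c f,
      g = u + X (Sum.inl p) * h := by
  obtain ⟨u, h, e, hh, hu⟩ := exists_eq_add_X_mul_of_coeff (Sum.inl p) g
  refine ⟨u, ⟨fun μ h1 h2 => ?_, fun μ hμ => ?_⟩, h, fun μ hμ => ?_, e⟩
  · rw [hu]
    split_ifs with h0
    · refine hg.1 μ (fun i hi => ?_) h2
      rcases Nat.lt_succ_iff_lt_or_eq.mp hi with h3 | h3
      · exact h1 i h3
      · rwa [Fin.ext h3]
    · rfl
  · rw [hu] at hμ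
    exact hg.2 μ fun h0 => hμ (by rw [h0, ite_self])
  · rw [hh] at hμ
    have := hg.2 _ hμ
    simp only [map_add, rowDeg_single_inl, colDeg_single_inl] at this
    push_cast at this
    lia

theorem exists_eq_add_X_inr_mul {p : ℕ} {q : Fin c} {f : ℤ}
    {g : MvPowerSeries (Fin m ⊕ Fin c) K} (hg : g ∈ initialSubgroup K m c p (q + 1) f) :
    ∃ u ∈ initialSubgroup K m c p q f, ∃ h ∈ weightSubgroup K m c (f + 1),
      g = u + X (Sum.inr q) * h := by
  obtain ⟨u, h, e, hh, hu⟩ := exists_eq_add_X_mul_of_coeff (Sum.inr q) g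
  refine ⟨u, ⟨fun μ h1 h2 => ?_, fun μ hμ => ?_⟩, h, fun μ hμ => ?_, e⟩
  · rw [hu]
    split_ifs with h0
    · refine hg.1 μ h1 (fun i hi => ?_)
      rcases Nat.lt_succ_iff_lt_or_eq.mp hi with h3 | h3
      · exact h2 i h3
      · rwa [Fin.ext h3]
    · rfl
  · rw [hu] at hμ
    exact hg.2 μ fun h0 => hμ (by rw [h0, ite_self])
  · rw [hh] at hμ
    have := hg.2 _ hμ
    simp only [map_add, rowDeg_single_inr, colDeg_single_inr] at this
    push_cast at this
    lia

theorem mem_initialIdeal_of_X_inr_mul {p : ℕ} {q : Fin c}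
    {g : MvPowerSeries (Fin m ⊕ Fin c) K}
    (h : X (Sum.inr q) * g ∈ initialIdeal K m c p q) : g ∈ initialIdeal K m c p q := by
  intro μ h1 h2
  rw [← coeff_single_add_X_mul (Sum.inr q)]
  refine h _ (fun i hi => by simpa using h1 i hi) fun j hj => ?_
  have : q ≠ j := by rintro rfl; exact lt_irrefl _ hj
  simpa [this] using h2 j hj

theorem mem_initialIdeal_of_X_inl_mul {p : Fin m} {q : ℕ}
    {g : MvPowerSeries (Fin m ⊕ Fin c) K}
    (h : X (Sum.inl p) * g ∈ initialIdeal K m c p q) : g ∈ initialIdeal K m c p q := by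
  intro μ h1 h2
  rw [← coeff_single_add_X_mul (Sum.inl p)]
  refine h _ (fun i hi => ?_) fun j hj => by simpa using h2 j hj
  have : p ≠ i := by rintro rfl; exact lt_irrefl _ hi
  simpa [this] using h1 i hi

theorem mul_mem_initialSubgroup {p q : ℕ} {f : ℤ} {r g : MvPowerSeries (Fin m ⊕ Fin c) K}
    (hr : r ∈ weightSubgroup K m c 0) (hg : g ∈ initialSubgroup K m c p q f) :
    r * g ∈ initialSubgroup K m c p q f :=
  ⟨Ideal.mul_mem_left _ _ hg.1, mul_mem_weightSubgroup hr hg.2 (zero_add f)⟩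

theorem regPair_antidiagSum (L p q f : ℕ) (hp : p ≤ m) (hL : L + q ≤ c) (hf : 1 ≤ m - p + f) :
    RegPair (initialSubgroup K m c p q f) (weightSubgroup K m c f)
      ((List.range' (p + q) L).map (antidiagSum K m c)) := by
  induction L generalizing p q f with
  | zero => trivial
  | succ L ih =>
    by_cases hpm : p = m
    · refine RegPair.of_le (fun g hg => mem_initialSubgroup.mpr ⟨fun μ h1 _ => ?_, hg⟩) _
      by_contra h
      have h2 := hg μ h
      have h3 : rowDeg μ = 0 := by
        rw [rowDeg_apply]
        exact Finset.sum_eq_zero fun i _ => h1 i (by lia)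
      lia
    obtain ⟨p, rfl⟩ : ∃ p' : Fin m, (p' : ℕ) = p := ⟨⟨p, by lia⟩, rfl⟩
    obtain ⟨q, rfl⟩ : ∃ q' : Fin c, (q' : ℕ) = q := ⟨⟨q, by lia⟩, rfl⟩
    have hsub := antidiagSum_sub_mem (K := K) p q
    have hrs : ∀ r ∈ (List.range' (p + q + 1) L).map (antidiagSum K m c),
        r ∈ weightSubgroup K m c 0 := by
      intro r hr
      obtain ⟨k, -, rfl⟩ := List.mem_map.mp hr
      exact antidiagSum_mem k
    have hw {f : ℤ} : ∀ r ∈ (List.range' (p + q + 1) L).map (antidiagSum K m c),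
        ∀ x ∈ weightSubgroup K m c f, r * x ∈ weightSubgroup K m c f :=
      fun r hr x hx => mul_mem_weightSubgroup (hrs r hr) hx (zero_add f)
    have hX {x} (hx : x ∈ weightSubgroup K m c (f + 1)) :
        X (Sum.inr q) * x ∈ weightSubgroup K m c f :=
      mul_mem_weightSubgroup (X_inr_mem_weightSubgroup q) hx (by ring)
    have ih1 := ih (p + 1) q (f + 1) (by lia) (by lia) (by lia)
    have ih2 := ih p (q + 1) f (by lia) (by lia) (by lia)
    rw [show (p + 1 + q : ℕ) = p + q + 1 by ring] at ih1
    rw [show (p + (q + 1) : ℕ) = p + q + 1 by ring] at ih2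
    push_cast at ih1
    rw [List.range'_succ, List.map_cons]
    refine ⟨fun x hx hdx => mem_initialSubgroup.mpr ⟨?_, hx⟩, RegPair.of_exact (X (Sum.inr q)) _ ?_ hw hw
      (fun y hy => hX hy) ?_ ?_ ?_ ih1 ih2⟩
    · refine mem_initialIdeal_of_X_inr_mul (mem_initialIdeal_of_X_inl_mul ?_)
      have := sub_mem (mem_initialSubgroup.mp hdx).1 (Ideal.mul_mem_right x _ hsub)
      rwa [← sub_mul, sub_sub_cancel, mul_assoc] at this
    · intro r hr x hx
      obtain ⟨y, hy, z, hz, rfl⟩ := mem_sup_map_mulLeft.mp hx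
      exact mem_sup_map_mulLeft.mpr ⟨r * y, mul_mem_initialSubgroup (hrs r hr) hy, r * z,
        hw r hr z hz, by ring⟩
    · intro y hy
      obtain ⟨u, hu, h, hh, rfl⟩ := exists_eq_add_X_inl_mul hy
      rw [mem_initialSubgroup] at hu
      refine mem_sup_map_mulLeft.mpr ⟨X (Sum.inr q) * u -
        (antidiagSum K m c (p + q) - X (Sum.inl p) * X (Sum.inr q)) * h,
        mem_initialSubgroup.mpr ⟨?_, ?_⟩, h, hh,
        by ring⟩
      · exact sub_mem (Ideal.mul_mem_left _ _ hu.1) (Ideal.mul_mem_right _ _ hsub)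
      · exact sub_mem (hX hu.2) (mul_mem_weightSubgroup (sub_mem (antidiagSum_mem _)
          (mul_mem_weightSubgroup (X_inl_mem_weightSubgroup p) (X_inr_mem_weightSubgroup q)
            (by simp))) hh (zero_add _))
    · intro y hy hay
      obtain ⟨u, hu, h, hh, e⟩ := mem_sup_map_mulLeft.mp hay
      rw [mem_initialSubgroup] at hu
      refine mem_initialSubgroup.mpr ⟨?_, hy⟩
      have h1 : X (Sum.inr q) * (y - X (Sum.inl p) * h) ∈ initialIdeal K m c p q := by
        have := add_mem hu.1 (Ideal.mul_mem_right h _ hsub)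
        convert this using 1
        linear_combination -e
      have h2 := initialIdeal_mono (Nat.le_succ p) le_rfl (mem_initialIdeal_of_X_inr_mul h1)
      have h3 := Ideal.mul_mem_right h _
        (X_inl_mem_initialIdeal (K := K) (c := c) (q := q) p (Nat.lt_succ_self p))
      simpa using add_mem h2 h3
    · intro x
      constructor
      · intro hx
        obtain ⟨u, hu, h, hh, rfl⟩ := exists_eq_add_X_inr_mul hx
        exact ⟨u, AddSubgroup.mem_sup_left hu, h, hh, rfl⟩
      · rintro ⟨y, hy, z, hz, rfl⟩
        obtain ⟨u, hu, h, hh, rfl⟩ := mem_sup_map_mulLeft.mp hy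
        rw [mem_initialSubgroup] at hu
        have hq := X_inr_mem_initialIdeal (K := K) (m := m) (p := p) q (Nat.lt_succ_self q)
        refine mem_initialSubgroup.mpr ⟨add_mem (add_mem ?_ ?_) ?_, add_mem (add_mem hu.2 ?_) (hX hz)⟩
        · exact initialIdeal_mono le_rfl (Nat.le_succ _) hu.1
        · refine Ideal.mul_mem_right _ _ ?_
          have := add_mem (initialIdeal_mono le_rfl (Nat.le_succ _) hsub)
            (Ideal.mul_mem_left _ (X (Sum.inl p)) hq)
          simpa using this
        · exact Ideal.mul_mem_right _ _ hq
        · exact mul_mem_weightSubgroup (antidiagSum_mem _) hh (zero_add _)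

end SegreSequence

section Determinantal

variable {m n}

theorem detx_mem_detJ (i : Fin m) (j : Fin n) (hj : (j : ℕ) < n - 1) :
    detx 𝕜 m n i j ∈ detJ 𝕜 m n :=
  Ideal.subset_span ⟨i, j, hj, rfl⟩

/-- The inclusion of the indices of the last column. -/
def lastCol (m : ℕ) (hn : 1 ≤ n) : Fin m ↪ Fin m × Fin n where
  toFun i := (i, ⟨n - 1, by lia⟩)
  inj' _ _ h := congrArg Prod.fst h

@[simp]
theorem lastCol_apply (hn : 1 ≤ n) (i : Fin m) : lastCol m hn i = (i, ⟨n - 1, by lia⟩) := rfl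

theorem killCompl_X_of_lt (hn : 1 ≤ n) (i : Fin m) (j : Fin n) (hj : (j : ℕ) < n - 1) :
    killCompl (R := 𝕜) (lastCol m hn) (X (i, j)) = 0 := by
  refine killCompl_X_eq_zero fun ⟨k, hk⟩ => ?_
  have : n - 1 = j := congrArg (fun s => (s.2 : ℕ)) hk
  lia

/-- Restriction to the last column. -/
def toLastCol (m : ℕ) (hn : 1 ≤ n) : DetR 𝕜 m n →+* MvPowerSeries (Fin m) 𝕜 :=
  Ideal.Quotient.lift (detI2 𝕜 m n) (killCompl (lastCol m hn)).toRingHom <| by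
    suffices h : detI2 𝕜 m n ≤ RingHom.ker (killCompl (R := 𝕜) (lastCol m hn)) from
      fun a ha => h ha
    rw [detI2, Ideal.span_le]
    rintro _ ⟨i, k, j, l, -, hjl, rfl⟩
    have hj : (j : ℕ) < n - 1 := by
      have : (j : ℕ) < l := hjl
      lia
    simp [RingHom.mem_ker, killCompl_X_of_lt 𝕜 hn _ _ hj]

@[simp]
theorem toLastCol_mk (hn : 1 ≤ n) (f : DetP 𝕜 m n) :
    toLastCol 𝕜 m hn (Ideal.Quotient.mk _ f) = killCompl (lastCol m hn) f := rfl

theorem toLastCol_surjective (hn : 1 ≤ n) : Function.Surjective (toLastCol 𝕜 m hn) := fun g =>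
  ⟨Ideal.Quotient.mk _ (rename (lastCol m hn) g), killCompl_rename_app g⟩

theorem ker_toLastCol (hn : 1 ≤ n) : RingHom.ker (toLastCol 𝕜 m hn) = detJ 𝕜 m n := by
  classical
  apply le_antisymm
  · intro x hx
    obtain ⟨f, rfl⟩ := Ideal.Quotient.mk_surjective x
    rw [RingHom.mem_ker, toLastCol_mk] at hx
    have hf := mem_span_X_image_of_coeff_eq_zero
      (Finset.univ.filter fun s : Fin m × Fin n => (s.2 : ℕ) < n - 1) f fun d hd => by
        obtain ⟨d, rfl⟩ : d ∈ Set.range (Finsupp.embDomain (lastCol m hn)) := by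
          rw [Finsupp.mem_range_embDomain_iff]
          intro s hs
          have hs' : ¬ (s.2 : ℕ) < n - 1 := fun h =>
            (Finsupp.mem_support_iff.mp hs) (hd s (by simpa using h))
          exact ⟨s.1, Prod.ext rfl (Fin.ext (by rw [lastCol_apply]; dsimp; lia))⟩
        rw [← coeff_killCompl, hx, map_zero]
    have := Ideal.mem_map_of_mem (Ideal.Quotient.mk (detI2 𝕜 m n)) hf
    refine (?_ : Ideal.map _ _ ≤ detJ 𝕜 m n) this
    rw [Ideal.map_span, Ideal.span_le]
    rintro _ ⟨_, ⟨s, hs, rfl⟩, rfl⟩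
    exact detx_mem_detJ 𝕜 s.1 s.2 (by simpa using hs)
  · rw [detJ, Ideal.span_le]
    rintro _ ⟨i, j, hj, rfl⟩
    exact killCompl_X_of_lt 𝕜 hn i j hj

theorem detJ_isPrime (hn : 1 ≤ n) : (detJ 𝕜 m n).IsPrime := by
  have : IsDomain (MvPowerSeries (Fin m) 𝕜) := NoZeroDivisors.to_isDomain _
  rw [← ker_toLastCol 𝕜 hn]
  exact RingHom.ker_isPrime _

theorem ringKrullDim_quotient_detJ (hn : 1 ≤ n) :
    ringKrullDim (DetR 𝕜 m n ⧸ detJ 𝕜 m n) = m := by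
  rw [ringKrullDim_eq_of_ringEquiv ((Ideal.quotEquivOfEq (ker_toLastCol 𝕜 hn).symm).trans
    (RingHom.quotientKerEquivOfSurjective (toLastCol_surjective 𝕜 hn))),
    ringKrullDim_mvPowerSeries_fin]

theorem detx_mul_detx (i k : Fin m) (j l : Fin n) :
    detx 𝕜 m n i j * detx 𝕜 m n k l = detx 𝕜 m n i l * detx 𝕜 m n k j := by
  rw [← sub_eq_zero, detx, detx, detx, detx, ← map_mul, ← map_mul, ← map_sub,
    Ideal.Quotient.eq_zero_iff_mem]
  exact minor_mem_detI2 𝕜 i k j l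

theorem detJ_mem_minimalPrimes (hm : 1 ≤ m) (hn : 1 ≤ n) :
    detJ 𝕜 m n ∈ (Ideal.span (Set.range fun j : Fin (n - 1) =>
      detx 𝕜 m n ⟨0, hm⟩ ⟨j, by lia⟩)).minimalPrimes := by
  refine ⟨⟨detJ_isPrime 𝕜 hn, ?_⟩, fun Q ⟨hQ, hle⟩ hQJ => ?_⟩
  · rw [Ideal.span_le]
    rintro _ ⟨j, rfl⟩
    exact detx_mem_detJ 𝕜 _ _ j.2
  · rw [detJ, Ideal.span_le]
    rintro _ ⟨i, j, hj, rfl⟩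
    have h1 : detx 𝕜 m n i j * detx 𝕜 m n ⟨0, hm⟩ ⟨n - 1, by lia⟩ ∈ Q := by
      rw [detx_mul_detx]
      exact Ideal.mul_mem_left _ _ (hle (Ideal.subset_span ⟨⟨j, hj⟩, rfl⟩))
    refine (hQ.mem_or_mem h1).resolve_right fun h => ?_
    have h2 := hQJ h
    rw [← ker_toLastCol 𝕜 hn, RingHom.mem_ker, detx, toLastCol_mk] at h2
    have h3 := (killCompl_X (R := 𝕜) (e := lastCol m hn) ⟨0, hm⟩).symm.trans h2
    simpa [X] using congrArg (coeff (Finsupp.single ⟨0, hm⟩ 1)) h3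

theorem height_detJ_le (hm : 1 ≤ m) (hn : 1 ≤ n) :
    (detJ 𝕜 m n).height ≤ (n - 1 : ℕ) := by
  refine (Ideal.height_le_card_of_mem_minimalPrimes_span (Set.finite_range _)
    (detJ_mem_minimalPrimes 𝕜 hm hn)).trans ?_
  rw [Nat.cast_le, ← Nat.card_coe_set_eq]
  simpa using Finite.card_range_le (fun j : Fin (n - 1) =>
      detx 𝕜 m n ⟨0, hm⟩ ⟨j, by lia⟩)

theorem isLocalRing_detR (hn : 1 ≤ n) : IsLocalRing (DetR 𝕜 m n) :=
  have : Nontrivial (DetR 𝕜 m n) := (toLastCol 𝕜 m hn).domain_nontrivial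
  IsLocalRing.of_surjective' (Ideal.Quotient.mk (detI2 𝕜 m n)) Ideal.Quotient.mk_surjective

/-- The embedding of `R` into `S`. -/
def toricEmb (m n : ℕ) : DetR 𝕜 m n →+* DetS 𝕜 m n :=
  Ideal.Quotient.lift (detI2 𝕜 m n) (toricMap 𝕜).toRingHom fun a ha => by
    rw [← ker_toricMap] at ha
    exact ha

@[simp]
theorem toricEmb_mk (f : DetP 𝕜 m n) :
    toricEmb 𝕜 m n (Ideal.Quotient.mk _ f) = toricMap 𝕜 f := rfl

theorem toricEmb_injective : Function.Injective (toricEmb 𝕜 m n) := by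
  rw [injective_iff_map_eq_zero]
  intro x hx
  obtain ⟨f, rfl⟩ := Ideal.Quotient.mk_surjective x
  rwa [Ideal.Quotient.eq_zero_iff_mem, ← ker_toricMap, RingHom.mem_ker]

theorem range_toricEmb (hn : 1 ≤ n) :
    (toricEmb 𝕜 m n).toAddMonoidHom.range = weightSubgroup 𝕜 m (n - 1) 0 := by
  ext g
  rw [mem_weightSubgroup]
  simp only [add_zero, Nat.cast_le]
  rw [← mem_range_toricMap 𝕜 hn]
  constructor
  · rintro ⟨x, rfl⟩
    obtain ⟨f, rfl⟩ := Ideal.Quotient.mk_surjective x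
    exact ⟨f, rfl⟩
  · rintro ⟨f, rfl⟩
    exact ⟨Ideal.Quotient.mk _ f, rfl⟩

/-- The sum of the entries of the first `n - 1` columns on the `k`-th antidiagonal. -/
def detAntidiag (m n k : ℕ) : DetR 𝕜 m n :=
  ∑ s : Fin m × Fin (n - 1), if (s.1 + s.2 : ℕ) = k then detx 𝕜 m n s.1 ⟨s.2, by lia⟩ else 0

theorem detAntidiag_mem_detJ (k : ℕ) : detAntidiag 𝕜 m n k ∈ detJ 𝕜 m n := by
  refine sum_mem fun s _ => ?_
  split_ifs
  · exact detx_mem_detJ 𝕜 _ _ s.2.2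
  · exact zero_mem _

theorem toricEmb_detAntidiag (k : ℕ) :
    toricEmb 𝕜 m n (detAntidiag 𝕜 m n k) = antidiagSum 𝕜 m (n - 1) k := by
  rw [detAntidiag, antidiagSum, map_sum]
  refine Finset.sum_congr rfl fun s _ => ?_
  split_ifs
  · rw [detx, toricEmb_mk, toricMap_X, X, X, monomial_mul_monomial, one_mul, detExp,
      dif_pos s.2.2]
  · exact map_zero _

theorem isWeaklyRegular_detAntidiag (hm : 1 ≤ m) (hn : 1 ≤ n) :
    RingTheory.Sequence.IsWeaklyRegular (DetR 𝕜 m n)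
      ((List.range' 0 (n - 1)).map (detAntidiag 𝕜 m n)) := by
  refine RegPair.isWeaklyRegular (toricEmb 𝕜 m n) (toricEmb_injective 𝕜) _ ?_
  have h := regPair_antidiagSum (K := 𝕜) (m := m) (c := n - 1) (n - 1) 0 0 0
    (by lia) (by lia) (by lia)
  rw [List.map_map, range_toricEmb 𝕜 hn]
  rw [Nat.cast_zero] at h
  convert h using 1
  · symm
    rw [AddSubgroup.eq_bot_iff_forall]
    intro g hg
    ext μ
    exact (mem_initialSubgroup.mp hg).1 μ (by simp) (by simp)
  · exact List.map_congr_left fun k _ => toricEmb_detAntidiag 𝕜 k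

theorem length_le_height_of_isWeaklyRegular {A : Type*} [CommRing A] [IsNoetherianRing A]
    (p : Ideal A) [p.IsPrime] (rs : List A) (hrs : ∀ r ∈ rs, r ∈ p)
    (h : RingTheory.Sequence.IsWeaklyRegular A rs) : (rs.length : ℕ∞) ≤ p.height := by
  have h1 := h.isRegular_of_isLocalization_of_mem (Localization.AtPrime p) p hrs
  have h2 := ringKrullDim_add_length_eq_ringKrullDim_of_isRegular _ h1
  rw [IsLocalization.AtPrime.ringKrullDim_eq_height p (Localization.AtPrime p), List.length_map] at h2
  have h3 : (0 : WithBot ℕ∞) ≤ ringKrullDim (Localization.AtPrime p ⧸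
      Ideal.ofList (rs.map (algebraMap A (Localization.AtPrime p)))) := by
    have : Nontrivial (Localization.AtPrime p ⧸
        Ideal.ofList (rs.map (algebraMap A (Localization.AtPrime p)))) := by
      rw [Ideal.Quotient.nontrivial_iff]
      intro h4
      exact h1.top_ne_smul (by rw [h4]; simp)
    exact ringKrullDim_nonneg_of_nontrivial
  have h4 : ((rs.length : ℕ∞) : WithBot ℕ∞) ≤ p.height := by
    rw [← h2]
    exact le_add_of_nonneg_left h3
  exact WithBot.coe_le_coe.mp h4

theorem isRegular_detAntidiag (hm : 1 ≤ m) (hn : 1 ≤ n) :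
    RingTheory.Sequence.IsRegular (DetR 𝕜 m n)
      ((List.range' 0 (n - 1)).map (detAntidiag 𝕜 m n)) := by
  have := isLocalRing_detR 𝕜 (m := m) hn
  refine (IsLocalRing.isRegular_iff_isWeaklyRegular_of_subset_maximalIdeal fun r hr => ?_).mpr
    (isWeaklyRegular_detAntidiag 𝕜 hm hn)
  obtain ⟨k, -, rfl⟩ := List.mem_map.mp hr
  exact IsLocalRing.le_maximalIdeal (detJ_isPrime 𝕜 hn).ne_top (detAntidiag_mem_detJ 𝕜 k)

theorem idealHeight_of_isPrime {A : Type} [CommRing A] (p : Ideal A) [hp : p.IsPrime] :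
    idealHeight p = p.height := by
  apply le_antisymm
  · exact sInf_le ⟨⟨p, hp⟩, le_rfl, (PrimeSpectrum.height_eq_orderHeight ⟨p, hp⟩).symm⟩
  · refine le_sInf ?_
    rintro _ ⟨q, hq, rfl⟩
    rw [← PrimeSpectrum.height_eq_orderHeight]
    exact Ideal.height_mono hq

theorem height_detJ (hm : 1 ≤ m) (hn : 1 ≤ n) : (detJ 𝕜 m n).height = (n - 1 : ℕ) := by
  have := detJ_isPrime 𝕜 (m := m) hn
  refine le_antisymm (height_detJ_le 𝕜 hm hn) ?_
  refine le_trans (by simp) (length_le_height_of_isWeaklyRegular (detJ 𝕜 m n) _ ?_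
    (isWeaklyRegular_detAntidiag 𝕜 hm hn))
  intro r hr
  obtain ⟨k, -, rfl⟩ := List.mem_map.mp hr
  exact detAntidiag_mem_detJ 𝕜 k

theorem idealGrade_detJ (hm : 1 ≤ m) (hn : 1 ≤ n) : idealGrade (detJ 𝕜 m n) = (n - 1 : ℕ) := by
  have := detJ_isPrime 𝕜 (m := m) hn
  apply le_antisymm
  · refine sSup_le ?_
    rintro _ ⟨rs, hrs, hreg, rfl⟩
    rw [← height_detJ 𝕜 hm hn]
    exact length_le_height_of_isWeaklyRegular _ rs hrs hreg.toIsWeaklyRegular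
  · refine le_sSup ⟨_, fun r hr => ?_, isRegular_detAntidiag 𝕜 hm hn, by simp⟩
    obtain ⟨k, -, rfl⟩ := List.mem_map.mp hr
    exact detAntidiag_mem_detJ 𝕜 k

end Determinantal

/-- `dim R/I = m`, `height I = n - 1`, and `grade I = n - 1`. -/
theorem statement0 (hm : 2 ≤ m) (hn : 2 ≤ n) :
    ringKrullDim (DetR 𝕜 m n ⧸ detJ 𝕜 m n) = (m : WithBot ℕ∞) ∧
    idealHeight (detJ 𝕜 m n) = ((n - 1 : ℕ) : ℕ∞) ∧
    idealGrade (detJ 𝕜 m n) = ((n - 1 : ℕ) : ℕ∞) := by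
  have hm' : 1 ≤ m := by lia
  have hn' : 1 ≤ n := by lia
  have := detJ_isPrime 𝕜 (m := m) hn'
  exact ⟨ringKrullDim_quotient_detJ 𝕜 hn',
    (idealHeight_of_isPrime _).trans (height_detJ 𝕜 hm' hn'), idealGrade_detJ 𝕜 hm' hn'⟩
end
end

section
/- For every integer α ≥ 0, the R-linear map ψ^α : I^α/I^{α+1} → 𝔞^α S/𝔞^{α+1}S induced by φ (which satisfies φ(I^α) ⊆ 𝔞^α S) is injective. -/
open CategoryTheory Opposite MvPowerSeries

set_option synthInstance.maxHeartbeats 1000000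
set_option maxHeartbeats 1000000

noncomputable section

variable (𝕜 : Type) [Field 𝕜] (m n : ℕ)

/-- A power series lies in an ideal generated by finitely many homogeneous power series as soon as
in each degree it agrees with some element of the ideal. -/
theorem mem_span_of_forall_degree {σ A : Type*} [CommRing A] {S : Set (MvPowerSeries σ A)}
    (hS : S.Finite) (hom : ∀ g ∈ S, ∃ e : ℕ, ∀ b, coeff b g ≠ 0 → b.degree = e)
    (f : MvPowerSeries σ A)
    (hf : ∀ d : ℕ, ∃ p ∈ Ideal.span S, ∀ M, M.degree = d → coeff M f = coeff M p) :
    f ∈ Ideal.span S := by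
  classical
  have := hS.fintype
  choose e he using fun g : S => hom g.1 g.2
  choose p hp hfp using hf
  have hp' : ∀ d, ∃ c : S → MvPowerSeries σ A, ∑ i, c i * (i : MvPowerSeries σ A) = p d := by
    intro d
    have := hp d
    rw [← Subtype.range_coe (s := S)] at this
    exact Ideal.mem_span_range_iff_exists_fun.1 this
  choose h hh using hp'
  let H : S → MvPowerSeries σ A := fun i a => coeff a (h (a.degree + e i) i)
  have key : f = ∑ i, H i * (i : MvPowerSeries σ A) := by
    ext M
    rw [hfp M.degree M rfl, ← hh, map_sum, map_sum]
    refine Finset.sum_congr rfl fun i _ => ?_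
    rw [coeff_mul, coeff_mul]
    refine Finset.sum_congr rfl fun ab hab => ?_
    by_cases hb : coeff ab.2 (i : MvPowerSeries σ A) = 0
    · simp [hb]
    · rw [Finset.HasAntidiagonal.mem_antidiagonal] at hab
      have hd : M.degree = ab.1.degree + e i := by
        rw [← hab, map_add, he i _ hb]
      rw [hd]
      rfl
  rw [key]
  exact Ideal.sum_mem _ fun i _ => Ideal.mul_mem_left _ _ (Ideal.subset_span i.2)

/-- The ideal of power series all of whose monomials have weight at least `k`. -/
def weightIdeal {σ : Type*} (A : Type*) [CommRing A] (w : (σ →₀ ℕ) →+ ℕ) (k : ℕ) :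
    Ideal (MvPowerSeries σ A) where
  carrier := {f | ∀ M, w M < k → coeff M f = 0}
  add_mem' hf hg M hM := by simp [hf M hM, hg M hM]
  zero_mem' M _ := by simp
  smul_mem' c f hf M hM := by
    classical
    rw [smul_eq_mul, coeff_mul]
    refine Finset.sum_eq_zero fun ab hab => ?_
    rw [Finset.HasAntidiagonal.mem_antidiagonal] at hab
    rw [hf ab.2 (by rw [← hab, map_add] at hM; lia), mul_zero]

theorem weightIdeal_mul_le {σ A : Type*} [CommRing A] (w : (σ →₀ ℕ) →+ ℕ) (a b : ℕ) :
    weightIdeal A w a * weightIdeal A w b ≤ weightIdeal A w (a + b) := by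
  classical
  refine Ideal.mul_le.2 fun f hf g hg M hM => ?_
  rw [coeff_mul]
  refine Finset.sum_eq_zero fun cd hcd => ?_
  rw [Finset.HasAntidiagonal.mem_antidiagonal] at hcd
  rw [← hcd, map_add] at hM
  rcases lt_or_ge (w cd.1) a with h | h
  · rw [hf _ h, zero_mul]
  · rw [hg _ (by lia), mul_zero]

theorem weightIdeal_one_pow_le {σ A : Type*} [CommRing A] (w : (σ →₀ ℕ) →+ ℕ) (k : ℕ) :
    weightIdeal A w 1 ^ k ≤ weightIdeal A w k := by
  induction k with
  | zero => exact fun f _ M hM => absurd hM (Nat.not_lt_zero _)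
  | succ k ih =>
    rw [pow_succ]
    exact (Ideal.mul_mono_left ih).trans (weightIdeal_mul_le w k 1)

theorem X_mem_weightIdeal {σ A : Type*} [CommRing A] (w : (σ →₀ ℕ) →+ ℕ) {s : σ} {k : ℕ}
    (hs : k ≤ w (Finsupp.single s 1)) : (X s : MvPowerSeries σ A) ∈ weightIdeal A w k := by
  classical
  intro M hM
  rw [coeff_X, if_neg]
  rintro rfl
  lia

theorem monomial_one_eq_prod {σ A : Type*} [CommRing A] (M : σ →₀ ℕ) :
    monomial M (1 : A) = M.prod fun s e => (X s : MvPowerSeries σ A) ^ e := by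
  induction M using Finsupp.induction_linear with
  | zero => simp [monomial_zero_one]
  | add M N hM hN =>
    classical
    rw [Finsupp.prod_add_index' (by simp) (fun _ _ _ => pow_add _ _ _), ← hM, ← hN,
      monomial_mul_monomial, one_mul]
  | single s e => simp [X_pow_eq]

/-- A product of powers of elements, where those indexed by `W` lie in `J`, lies in the
corresponding power of `J`. -/
theorem prod_pow_mem_pow {σ B : Type*} [Fintype σ] [CommRing B] (J : Ideal B) (y : σ → B)
    (W : σ → Prop) [DecidablePred W] (hW : ∀ s, W s → y s ∈ J) (M : σ →₀ ℕ) {k : ℕ}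
    (hk : k ≤ ∑ s, if W s then M s else 0) : (M.prod fun s e => y s ^ e) ∈ J ^ k := by
  classical
  refine Ideal.pow_le_pow_right hk ?_
  rw [Finsupp.prod_fintype _ _ (by simp), ← Finset.prod_pow_eq_pow_sum]
  refine Ideal.prod_mem_prod fun s _ => ?_
  split_ifs with h
  · exact Ideal.pow_mem_pow (hW s h) _
  · simp

/-- If `y` satisfies the `2 × 2` minor relations, a product of values of `y` depends only on the
multisets of row and of column indices. -/
theorem prod_map_eq_of_map_fst_eq_of_map_snd_eq {ι κ B : Type*} [CommMonoid B] (y : ι × κ → B)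
    (hy : ∀ i j k l, y (i, j) * y (k, l) = y (i, l) * y (k, j)) (s t : Multiset (ι × κ))
    (h₁ : s.map Prod.fst = t.map Prod.fst) (h₂ : s.map Prod.snd = t.map Prod.snd) :
    (s.map y).prod = (t.map y).prod := by
  classical
  induction s using Multiset.induction_on generalizing t with
  | empty =>
    rw [Multiset.map_zero, eq_comm, Multiset.map_eq_zero] at h₁
    rw [h₁]
  | cons a s ih =>
    obtain ⟨i, j⟩ := a
    by_cases hij : (i, j) ∈ t
    · obtain ⟨t, rfl⟩ := Multiset.exists_cons_of_mem hij
      simp only [Multiset.map_cons, Multiset.cons_inj_right, Multiset.prod_cons] at h₁ h₂ ⊢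
      rw [ih t h₁ h₂]
    · obtain ⟨⟨i', l⟩, hil, rfl⟩ : ∃ a ∈ t, a.1 = i :=
        Multiset.mem_map.1 (h₁ ▸ by simp)
      obtain ⟨⟨k, j'⟩, hkj, rfl⟩ : ∃ a ∈ t, a.2 = j :=
        Multiset.mem_map.1 (h₂ ▸ by simp)
      obtain ⟨t, rfl⟩ := Multiset.exists_cons_of_mem hil
      have hkj' : (k, j') ∈ t := by
        rcases Multiset.mem_cons.1 hkj with h | h
        · rw [Prod.mk.injEq] at h
          exact absurd (by simp [h.2]) hij
        · exact h
      obtain ⟨t, rfl⟩ := Multiset.exists_cons_of_mem hkj'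
      have := ih ((k, l) ::ₘ t)
      simp only [Multiset.map_cons, Multiset.cons_inj_right, Multiset.prod_cons] at h₁ h₂ this ⊢
      rw [this h₁ (by rwa [Multiset.cons_swap, Multiset.cons_inj_right] at h₂), ← mul_assoc,
        ← mul_assoc, hy]

open scoped Pointwise in
theorem finite_pow_of_finite {B : Type*} [CommMonoid B] {S : Set B} (hS : S.Finite) (k : ℕ) :
    (S ^ k).Finite := by
  induction k with
  | zero => simp
  | succ k ih =>
    rw [pow_succ]
    exact ih.mul hS

open scoped Pointwise in
theorem degree_eq_of_mem_image_X_pow {σ A : Type*} [CommRing A] (W : Set σ) (k : ℕ) :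
    ∀ g ∈ ((X : σ → MvPowerSeries σ A) '' W) ^ k, ∀ b, coeff b g ≠ 0 → b.degree = k := by
  classical
  induction k with
  | zero =>
    intro g hg b hb
    rw [pow_zero, Set.mem_one] at hg
    subst hg
    rw [coeff_one] at hb
    split_ifs at hb with h <;> simp_all
  | succ k ih =>
    intro g hg b hb
    rw [pow_succ] at hg
    obtain ⟨u, hu, _, ⟨s, -, rfl⟩, rfl⟩ := Set.mem_mul.1 hg
    rw [coeff_mul] at hb
    obtain ⟨cd, hcd, h⟩ := Finset.exists_ne_zero_of_sum_ne_zero hb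
    rw [Finset.HasAntidiagonal.mem_antidiagonal] at hcd
    have h₂ := right_ne_zero_of_mul h
    rw [coeff_X] at h₂
    rw [← hcd, map_add, ih u hu _ (left_ne_zero_of_mul h)]
    split_ifs at h₂ with h₃ <;> simp_all

/-- The sum of the terms of degree at most `d` of a power series. -/
def degreeTrunc {σ A : Type*} [Finite σ] [CommRing A] (d : ℕ) (f : MvPowerSeries σ A) :
    MvPowerSeries σ A :=
  ∑ M ∈ (Finsupp.finite_of_degree_le (σ := σ) d).toFinset, monomial M (coeff M f)

theorem coeff_degreeTrunc {σ A : Type*} [Finite σ] [CommRing A] {d : ℕ} (f : MvPowerSeries σ A)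
    {M : σ →₀ ℕ} (hM : M.degree ≤ d) : coeff M (degreeTrunc d f) = coeff M f := by
  classical
  simp [degreeTrunc, coeff_monomial, hM]

open scoped Pointwise in
/-- Power series without terms of degree less than `k` lie in the `k`-th power of the ideal
generated by the variables. -/
theorem mem_span_X_pow {σ A : Type*} [Finite σ] [CommRing A] (k : ℕ)
    (f : MvPowerSeries σ A) (hf : ∀ M, M.degree < k → coeff M f = 0) :
    f ∈ Ideal.span ((X : σ → MvPowerSeries σ A) '' Set.univ) ^ k := by
  classical
  have := Fintype.ofFinite σ
  suffices h : f ∈ Ideal.span (((X : σ → MvPowerSeries σ A) '' Set.univ) ^ k) by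
    rwa [Ideal.span, ← Submodule.span_pow] at h
  refine mem_span_of_forall_degree (finite_pow_of_finite (Set.finite_univ.image _) k)
    (fun g hg => ⟨k, degree_eq_of_mem_image_X_pow _ k g hg⟩) f fun d =>
      ⟨degreeTrunc d f, ?_, fun M hM => (coeff_degreeTrunc f hM.le).symm⟩
  rw [Ideal.span, ← Submodule.span_pow]
  refine Ideal.sum_mem _ fun M _ => ?_
  rcases lt_or_ge M.degree k with h | h
  · simp [hf M h]
  · rw [← mul_one (coeff M f), ← smul_eq_mul, map_smul, smul_eq_C_mul, monomial_one_eq_prod]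
    refine Ideal.mul_mem_left _ _ (prod_pow_mem_pow _ _ (fun _ => True)
      (fun s _ => Ideal.subset_span (Set.mem_image_of_mem X (Set.mem_univ s))) M ?_)
    simpa [Finsupp.degree_eq_sum] using h

variable {𝕜 m n} in
/-- The exponent of the image of the variable `x_{ij}` under `φ`. -/
def cellExponent (s : Fin m × Fin n) : (Fin m ⊕ Fin (n - 1)) →₀ ℕ :=
  Finsupp.single (Sum.inl s.1) 1 +
    if h : (s.2 : ℕ) < n - 1 then Finsupp.single (Sum.inr ⟨s.2, h⟩) 1 else 0

/-- The exponent of the image of a monomial under `φ`. -/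
def phiExponent : (Fin m × Fin n →₀ ℕ) →+ ((Fin m ⊕ Fin (n - 1)) →₀ ℕ) :=
  (Finsupp.linearCombination ℕ cellExponent).toAddMonoidHom

/-- The total degree in the variables `x_1, …, x_m` of `S`. -/
def xWeight : ((Fin m ⊕ Fin (n - 1)) →₀ ℕ) →+ ℕ :=
  ∑ i : Fin m, Finsupp.applyAddHom (Sum.inl i)

/-- The total degree in the variables `a_1, …, a_{n-1}` of `S`. -/
def aWeight : ((Fin m ⊕ Fin (n - 1)) →₀ ℕ) →+ ℕ :=
  ∑ j : Fin (n - 1), Finsupp.applyAddHom (Sum.inr j)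

theorem phiExponent_single (s : Fin m × Fin n) (e : ℕ) :
    phiExponent m n (Finsupp.single s e) = e • cellExponent s := by
  simp [phiExponent]

theorem xWeight_cellExponent (s : Fin m × Fin n) : xWeight m n (cellExponent s) = 1 := by
  classical
  unfold xWeight cellExponent
  split_ifs <;> simp [Finsupp.single_apply]

theorem aWeight_cellExponent (s : Fin m × Fin n) :
    aWeight m n (cellExponent s) = if (s.2 : ℕ) < n - 1 then 1 else 0 := by
  classical
  unfold aWeight cellExponent
  split_ifs <;> simp [Finsupp.single_apply]

theorem xWeight_phiExponent (M : Fin m × Fin n →₀ ℕ) :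
    xWeight m n (phiExponent m n M) = M.degree := by
  induction M using Finsupp.induction_linear with
  | zero => simp
  | add M N hM hN => simp [hM, hN]
  | single s e => simp [phiExponent_single, xWeight_cellExponent]

theorem aWeight_phiExponent (M : Fin m × Fin n →₀ ℕ) :
    aWeight m n (phiExponent m n M) = ∑ s, if (s.2 : ℕ) < n - 1 then M s else 0 := by
  classical
  induction M using Finsupp.induction_linear with
  | zero => simp
  | add M N hM hN =>
    simp only [map_add, hM, hN, ← Finset.sum_add_distrib, Finsupp.add_apply]
    exact Finset.sum_congr rfl fun s _ => by split_ifs <;> simp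
  | single s e =>
    rw [phiExponent_single, map_nsmul, aWeight_cellExponent, Finset.sum_eq_single s]
    · simp
    · intro t _ ht
      simp [ht.symm]
    · simp

theorem mapDomain_fst_apply (M : Fin m × Fin n →₀ ℕ) (i : Fin m) :
    M.mapDomain Prod.fst i = phiExponent m n M (Sum.inl i) := by
  classical
  induction M using Finsupp.induction_linear with
  | zero => simp
  | add M N hM hN => simp [Finsupp.mapDomain_add, hM, hN]
  | single s e =>
    rw [phiExponent_single, cellExponent]
    split_ifs <;> simp [Finsupp.single_apply]

theorem mapDomain_snd_apply (M : Fin m × Fin n →₀ ℕ) (j : Fin n) :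
    M.mapDomain Prod.snd j + (if (j : ℕ) < n - 1 then 0 else
      aWeight m n (phiExponent m n M)) =
    if h : (j : ℕ) < n - 1 then phiExponent m n M (Sum.inr ⟨j, h⟩) else
      xWeight m n (phiExponent m n M) := by
  classical
  induction M using Finsupp.induction_linear with
  | zero => simp
  | add M N hM hN =>
    rw [Finsupp.mapDomain_add]
    split_ifs at hM hN ⊢ <;> simp only [map_add, Finsupp.add_apply] <;> lia
  | single s e =>
    rw [phiExponent_single, map_nsmul, map_nsmul, aWeight_cellExponent, xWeight_cellExponent,
      cellExponent]
    have hs := s.2.isLt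
    have hj := j.isLt
    by_cases h₁ : (j : ℕ) < n - 1 <;> by_cases h₂ : (s.2 : ℕ) < n - 1 <;>
      simp [Finsupp.single_apply, h₁, h₂, Fin.ext_iff] <;> grind

/-- The class in `R` of a monomial depends only on its image under `φ`. -/
theorem prod_detx_eq_of_phiExponent_eq {M N : Fin m × Fin n →₀ ℕ}
    (h : phiExponent m n M = phiExponent m n N) :
    (M.prod fun s e => detx 𝕜 m n s.1 s.2 ^ e) = N.prod fun s e => detx 𝕜 m n s.1 s.2 ^ e := by
  classical
  have hrel : ∀ i k j l, i < k → j < l →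
      detx 𝕜 m n i j * detx 𝕜 m n k l = detx 𝕜 m n i l * detx 𝕜 m n k j := by
    intro i k j l hik hjl
    rw [← sub_eq_zero]
    exact Ideal.Quotient.eq_zero_iff_mem.2 (Ideal.subset_span ⟨i, k, j, l, hik, hjl, rfl⟩)
  have hy : ∀ i j k l,
      detx 𝕜 m n i j * detx 𝕜 m n k l = detx 𝕜 m n i l * detx 𝕜 m n k j := by
    intro i j k l
    rcases lt_trichotomy i k with h₁ | rfl | h₁
    · rcases lt_trichotomy j l with h₂ | rfl | h₂
      · exact hrel _ _ _ _ h₁ h₂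
      · rfl
      · exact (hrel _ _ _ _ h₁ h₂).symm
    · exact mul_comm _ _
    · rw [mul_comm, mul_comm (detx 𝕜 m n i l)]
      rcases lt_trichotomy j l with h₂ | rfl | h₂
      · exact (hrel _ _ _ _ h₁ h₂).symm
      · rfl
      · exact hrel _ _ _ _ h₁ h₂
  have hprod : ∀ M : Fin m × Fin n →₀ ℕ, (M.prod fun s e => detx 𝕜 m n s.1 s.2 ^ e) =
      ((Finsupp.toMultiset M).map fun s => detx 𝕜 m n s.1 s.2).prod := fun M => by
    rw [Finsupp.toMultiset_map, Finsupp.prod_toMultiset, Finsupp.prod_mapDomain_index] <;>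
      simp [pow_add]
  rw [hprod, hprod]
  refine prod_map_eq_of_map_fst_eq_of_map_snd_eq (fun s => detx 𝕜 m n s.1 s.2) hy _ _ ?_ ?_
  · rw [Finsupp.toMultiset_map, Finsupp.toMultiset_map]
    congr 1
    ext i
    rw [mapDomain_fst_apply, mapDomain_fst_apply, h]
  · rw [Finsupp.toMultiset_map, Finsupp.toMultiset_map]
    congr 1
    ext j
    have hM := mapDomain_snd_apply m n M j
    have hN := mapDomain_snd_apply m n N j
    rw [h] at hM
    lia

variable {𝕜 m n} in
theorem mk_monomial (M : Fin m × Fin n →₀ ℕ) (c : 𝕜) :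
    Ideal.Quotient.mk (detI2 𝕜 m n) (monomial M c) =
      c • M.prod fun s e => detx 𝕜 m n s.1 s.2 ^ e := by
  rw [← mul_one c, ← smul_eq_mul, map_smul, monomial_one_eq_prod, smul_eq_mul, mul_one,
    Finsupp.prod, Finsupp.prod]
  simp only [detx, ← map_pow, ← map_prod]
  rfl

variable {𝕜 m n} in
theorem IsDetPhi.apply_detx {φ : DetR 𝕜 m n →ₐ[𝕜] DetS 𝕜 m n} (hφ : IsDetPhi 𝕜 m n φ)
    (s : Fin m × Fin n) : φ (detx 𝕜 m n s.1 s.2) = monomial (cellExponent s) 1 := by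
  classical
  rw [hφ, cellExponent]
  split_ifs
  · rw [X, X, monomial_mul_monomial, one_mul, add_comm]
  · rw [X, add_zero]

variable {𝕜 m n} in
theorem IsDetPhi.apply_mk_monomial {φ : DetR 𝕜 m n →ₐ[𝕜] DetS 𝕜 m n}
    (hφ : IsDetPhi 𝕜 m n φ) (M : Fin m × Fin n →₀ ℕ) (c : 𝕜) :
    φ (Ideal.Quotient.mk (detI2 𝕜 m n) (monomial M c)) = monomial (phiExponent m n M) c := by
  classical
  have h : φ (M.prod fun s e => detx 𝕜 m n s.1 s.2 ^ e) = monomial (phiExponent m n M) 1 := by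
    induction M using Finsupp.induction_linear with
    | zero => simp [monomial_zero_one]
    | add M N hM hN =>
      rw [Finsupp.prod_add_index' (by simp) (fun _ _ _ => pow_add _ _ _), map_mul, hM, hN,
        monomial_mul_monomial, one_mul, map_add]
    | single s e =>
      rw [Finsupp.prod_single_index (by simp), map_pow, hφ.apply_detx, phiExponent_single,
        monomial_pow, one_pow]
  rw [mk_monomial, map_smul, h, ← map_smul, smul_eq_mul, mul_one]

variable {𝕜 m n} in
/-- The coefficients of `φ f` of `x`-degree at most `d` are finite sums of coefficients of `f`. -/
theorem IsDetPhi.coeff_apply_mk {φ : DetR 𝕜 m n →ₐ[𝕜] DetS 𝕜 m n}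
    (hφ : IsDetPhi 𝕜 m n φ) (f : DetP 𝕜 m n) {d : ℕ} {κ : (Fin m ⊕ Fin (n - 1)) →₀ ℕ}
    (hκ : xWeight m n κ ≤ d) :
    coeff κ (φ (Ideal.Quotient.mk (detI2 𝕜 m n) f)) =
      ∑ M ∈ (Finsupp.finite_of_degree_le (σ := Fin m × Fin n) d).toFinset with
        phiExponent m n M = κ, coeff M f := by
  classical
  let Φ : DetP 𝕜 m n →+* DetS 𝕜 m n := (φ : DetR 𝕜 m n →+* DetS 𝕜 m n).comp
    (Ideal.Quotient.mk (detI2 𝕜 m n))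
  have hX : Ideal.span ((X : Fin m × Fin n → DetP 𝕜 m n) '' Set.univ) ≤
      (weightIdeal 𝕜 (xWeight m n) 1).comap Φ := by
    rw [Ideal.span_le]
    rintro _ ⟨s, -, rfl⟩ M hM
    have : Φ (X s) = monomial (cellExponent s) 1 := hφ.apply_detx s
    rw [this, coeff_monomial, if_neg]
    rintro rfl
    rw [xWeight_cellExponent] at hM
    lia
  have hrest : Φ (f - degreeTrunc d f) ∈ weightIdeal 𝕜 (xWeight m n) (d + 1) := by
    refine weightIdeal_one_pow_le _ _ ?_
    have := mem_span_X_pow (d + 1) (f - degreeTrunc d f) fun M hM => by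
      rw [map_sub, coeff_degreeTrunc f (by lia), sub_self]
    exact Ideal.le_comap_pow Φ (d + 1) (Ideal.pow_right_mono hX _ this)
  have h₀ : coeff κ (Φ f) = coeff κ (Φ (degreeTrunc d f)) := by
    rw [← sub_eq_zero, ← map_sub, ← map_sub]
    exact hrest κ (by lia)
  change coeff κ (Φ f) = _
  rw [h₀, degreeTrunc, map_sum, map_sum, Finset.sum_filter]
  refine Finset.sum_congr rfl fun M _ => ?_
  have : Φ (monomial M (coeff M f)) = monomial (phiExponent m n M) (coeff M f) :=
    hφ.apply_mk_monomial M _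
  rw [this, coeff_monomial]
  simp only [eq_comm]

theorem detA_pow_le (k : ℕ) : detA 𝕜 m n ^ k ≤ weightIdeal 𝕜 (aWeight m n) k := by
  classical
  refine (Ideal.pow_right_mono ?_ k).trans (weightIdeal_one_pow_le _ k)
  rw [detA, Ideal.span_le]
  rintro _ ⟨j, rfl⟩
  exact X_mem_weightIdeal _ (by simp [aWeight, Finsupp.single_apply])

open scoped Pointwise in
/-- The preimage of `I ^ k` in `P` has a finite set of homogeneous generators. -/
theorem exists_homogeneous_generators_comap_detJ_pow (k : ℕ) :
    ∃ S : Set (DetP 𝕜 m n), S.Finite ∧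
      (∀ g ∈ S, ∃ e : ℕ, ∀ b, coeff b g ≠ 0 → b.degree = e) ∧
      (detJ 𝕜 m n ^ k).comap (Ideal.Quotient.mk (detI2 𝕜 m n)) = Ideal.span S := by
  classical
  let W : Set (Fin m × Fin n) := {s | (s.2 : ℕ) < n - 1}
  let minors : Set (DetP 𝕜 m n) := {f | ∃ (i k : Fin m) (j l : Fin n), i < k ∧ j < l ∧
    f = X (i, j) * X (k, l) - X (i, l) * X (k, j)}
  have hJ : detJ 𝕜 m n =
      (Ideal.span (X '' W)).map (Ideal.Quotient.mk (detI2 𝕜 m n)) := by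
    rw [Ideal.map_span, detJ]
    congr 1
    ext x
    constructor
    · rintro ⟨i, j, hj, rfl⟩
      exact ⟨_, ⟨(i, j), hj, rfl⟩, rfl⟩
    · rintro ⟨_, ⟨⟨i, j⟩, hj, rfl⟩, rfl⟩
      exact ⟨i, j, hj, rfl⟩
  refine ⟨minors ∪ (X '' W) ^ k, ?_, ?_, ?_⟩
  · refine Set.Finite.union (Set.Finite.subset (Set.finite_range
      fun p : Fin m × Fin m × Fin n × Fin n => (X (p.1, p.2.2.1) * X (p.2.1, p.2.2.2) -
        X (p.1, p.2.2.2) * X (p.2.1, p.2.2.1) : DetP 𝕜 m n)) ?_) (finite_pow_of_finite (W.toFinite.image _) k)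
    rintro _ ⟨i, k, j, l, -, -, rfl⟩
    exact ⟨(i, k, j, l), rfl⟩
  · rintro g (⟨i, k, j, l, -, -, rfl⟩ | hg)
    · refine ⟨2, fun b hb => ?_⟩
      rw [X, X, X, X, monomial_mul_monomial, monomial_mul_monomial, map_sub, coeff_monomial,
        coeff_monomial] at hb
      by_cases h₁ : b = Finsupp.single (i, j) 1 + Finsupp.single (k, l) 1
      · simp [h₁]
      · by_cases h₂ : b = Finsupp.single (i, l) 1 + Finsupp.single (k, j) 1
        · simp [h₂]
        · simp [h₁, h₂] at hb
    · exact ⟨k, degree_eq_of_mem_image_X_pow _ k g hg⟩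
  · have hpow : Ideal.span ((X '' W : Set (DetP 𝕜 m n))) ^ k = Ideal.span ((X '' W) ^ k) :=
      Submodule.span_pow _ k
    rw [hJ, ← Ideal.map_pow, Ideal.comap_map_quotientMk, Ideal.span_union, hpow]
    rfl

/-- for every `α ≥ 0`, the induced `R`-linear map
`ψ^α : I^α/I^{α+1} → 𝔞^α S/𝔞^{α+1} S` is injective.  Injectivity of `ψ^α` is expressed
elementwise: any `r ∈ I^α` whose image `φ r` lies in `𝔞^{α+1} S` (i.e. whose class is sent
to `0` by `ψ^α`) already lies in `I^{α+1}`. -/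
theorem statement2 (hm : 2 ≤ m) (hn : 2 ≤ n)
    (φ : DetR 𝕜 m n →ₐ[𝕜] DetS 𝕜 m n) (hφ : IsDetPhi 𝕜 m n φ) (α : ℕ) :
    ∀ r ∈ detJ 𝕜 m n ^ α, φ r ∈ detA 𝕜 m n ^ (α + 1) → r ∈ detJ 𝕜 m n ^ (α + 1) := by
  classical
  intro r _ hr
  obtain ⟨f, rfl⟩ := Ideal.Quotient.mk_surjective r
  obtain ⟨S, hS, hom, hspan⟩ := exists_homogeneous_generators_comap_detJ_pow 𝕜 m n (α + 1)
  rw [← Ideal.mem_comap, hspan]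
  refine mem_span_of_forall_degree hS hom f fun d =>
    ⟨degreeTrunc d f, ?_, fun M hM => (coeff_degreeTrunc f hM.le).symm⟩
  rw [← hspan, Ideal.mem_comap, degreeTrunc, map_sum,
    ← Finset.sum_fiberwise_of_maps_to fun M hM => Finset.mem_image_of_mem (phiExponent m n) hM]
  refine Ideal.sum_mem _ fun κ hκ => ?_
  obtain ⟨N, hN, rfl⟩ := Finset.mem_image.1 hκ
  have hsum : ∑ M ∈ (Finsupp.finite_of_degree_le (σ := Fin m × Fin n) d).toFinset with
      phiExponent m n M = phiExponent m n N,
        Ideal.Quotient.mk (detI2 𝕜 m n) (monomial M (coeff M f)) =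
      Ideal.Quotient.mk (detI2 𝕜 m n) (monomial N
        (coeff (phiExponent m n N) (φ (Ideal.Quotient.mk (detI2 𝕜 m n) f)))) := by
    rw [hφ.coeff_apply_mk f (d := d) (by simpa [xWeight_phiExponent] using hN), map_sum, map_sum]
    refine Finset.sum_congr rfl fun M hM => ?_
    rw [mk_monomial, mk_monomial,
      prod_detx_eq_of_phiExponent_eq 𝕜 m n (Finset.mem_filter.1 hM).2]
  rw [hsum]
  rcases lt_or_ge (aWeight m n (phiExponent m n N)) (α + 1) with h | h
  · rw [detA_pow_le 𝕜 m n _ hr _ h, map_zero, map_zero]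
    exact zero_mem _
  · have hW : ∀ s : Fin m × Fin n, (s.2 : ℕ) < n - 1 → detx 𝕜 m n s.1 s.2 ∈ detJ 𝕜 m n := by
      intro s hs
      rw [detJ]
      exact Ideal.subset_span ⟨s.1, s.2, hs, rfl⟩
    have hmem : (N.prod fun s e => detx 𝕜 m n s.1 s.2 ^ e) ∈ detJ 𝕜 m n ^ (α + 1) := by
      refine prod_pow_mem_pow _ (fun s : Fin m × Fin n => detx 𝕜 m n s.1 s.2)
        (fun s => (s.2 : ℕ) < n - 1) hW N ?_
      rwa [aWeight_phiExponent] at h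
    rw [← one_smul 𝕜 (N.prod _), ← mk_monomial] at hmem
    rw [← mul_one (coeff _ _), ← smul_eq_mul, map_smul, smul_eq_C_mul, map_mul]
    exact Ideal.mul_mem_left _ _ hmem
end
end

section
/- For every integer α ≥ 1, the cokernel C_α of the injective homomorphism φ^α : R/I^α → S/𝔞^α S has finite length as an R-module. -/
open CategoryTheory Opposite MvPowerSeries

set_option synthInstance.maxHeartbeats 1000000
set_option maxHeartbeats 1000000

noncomputable section

variable (𝕜 : Type) [Field 𝕜] (m n : ℕ)

namespace MvPowerSeries

variable {σ τ : Type*} {k : Type*}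

/-- If `c` selects for each exponent `d` in the support of `f` an exponent `c d ≤ d` lying in a
finite set `T`, then `f` is a combination of the monomials with exponents in `T`, with explicit
coefficients. -/
theorem eq_sum_monomial_mul [CommSemiring k] (f : MvPowerSeries σ k) (T : Finset (σ →₀ ℕ))
    (c : (σ →₀ ℕ) → (σ →₀ ℕ)) (hT : ∀ d, coeff d f ≠ 0 → c d ∈ T) (hc : ∀ d, c d ≤ d) :
    ∃ g : (σ →₀ ℕ) → MvPowerSeries σ k,
      (∀ t e, coeff e (g t) ≠ 0 → c (e + t) = t) ∧
      f = ∑ t ∈ T, monomial t 1 * g t := by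
  classical
  let g (t : σ →₀ ℕ) : MvPowerSeries σ k :=
    fun e => if c (e + t) = t then coeff (e + t) f else 0
  refine ⟨g, fun t e h => ?_, ?_⟩
  · by_contra h'
    exact h (if_neg h')
  · ext d
    rw [map_sum]
    have key : ∀ t ∈ T, coeff d (monomial t (1 : k) * g t) =
        if c d = t then coeff d f else 0 := by
      intro t _
      rw [coeff_monomial_mul]
      split_ifs with h1 h2 h2
      · simp only [one_mul]
        change (if c (d - t + t) = t then coeff (d - t + t) f else 0) = _
        rw [tsub_add_cancel_of_le h1, if_pos h2]
      · simp only [one_mul]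
        change (if c (d - t + t) = t then coeff (d - t + t) f else 0) = _
        rw [tsub_add_cancel_of_le h1, if_neg h2]
      · exact absurd (h2 ▸ hc d) h1
      · rfl
    rw [Finset.sum_congr rfl key, Finset.sum_ite_eq]
    split_ifs with h
    · rfl
    · by_contra h'
      exact h (hT d h')

theorem monomial_one_mem_pow [CommSemiring k] [Finite σ] (J : Ideal (MvPowerSeries σ k))
    (hJ : ∀ i, X i ∈ J) (t : σ →₀ ℕ) : monomial t 1 ∈ J ^ t.degree := by
  cases nonempty_fintype σ
  rw [monomial_one_eq, Finsupp.prod_fintype _ _ (by simp), Finsupp.degree_eq_sum,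
    ← Finset.prod_pow_eq_pow_sum]
  exact Ideal.prod_mem_prod fun i _ => Ideal.pow_mem_pow (hJ i) _

theorem mem_span_X_pow [CommSemiring k] [Finite σ] {N : ℕ} {f : MvPowerSeries σ k}
    (hf : ∀ d, d.degree < N → coeff d f = 0) :
    f ∈ Ideal.span (Set.range (X : σ → MvPowerSeries σ k)) ^ N := by
  classical
  have h : ∀ d : σ →₀ ℕ, ∃ t ≤ d, N ≤ d.degree → t.degree = N := fun d => by
    by_cases hd : N ≤ d.degree
    · obtain ⟨t, ht, ht'⟩ := Finsupp.exists_le_degree_eq d N hd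
      exact ⟨t, ht, fun _ => ht'⟩
    · exact ⟨d, le_rfl, fun h => absurd h hd⟩
  choose c hc hc' using h
  obtain ⟨g, -, rfl⟩ := eq_sum_monomial_mul f (Finsupp.finite_of_degree_eq (σ := σ) N).toFinset c
    (fun d hd => by
      simp only [Set.Finite.mem_toFinset, Set.mem_ofPred_eq]
      exact hc' d (not_lt.1 fun h => hd (hf d h))) hc
  refine Ideal.sum_mem _ fun t ht => Ideal.mul_mem_right _ _ ?_
  simp only [Set.Finite.mem_toFinset, Set.mem_ofPred_eq] at ht
  rw [← ht]
  exact monomial_one_mem_pow _ (fun i => Ideal.subset_span (Set.mem_range_self i)) t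

/-- An algebra homomorphism between power series rings in finitely many variables which sends
variables to series without constant term is determined by its values on the variables. -/
theorem algHom_ext_of_constantCoeff [CommRing k] [Finite σ]
    (F G : MvPowerSeries σ k →ₐ[k] MvPowerSeries τ k)
    (h : ∀ i, F (X i) = G (X i)) (h0 : ∀ i, constantCoeff (F (X i)) = 0) : F = G := by
  classical
  have hmap : ∀ (H : MvPowerSeries σ k →ₐ[k] MvPowerSeries τ k),
      (∀ i, constantCoeff (H (X i)) = 0) → ∀ (N : ℕ) (f : MvPowerSeries σ k),
      (∀ d, d.degree < N → coeff d f = 0) → ∀ e : τ →₀ ℕ, e.degree < N → coeff e (H f) = 0 := by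
    intro H hH N f hf e he
    have h1 : H f ∈ (RingHom.ker (constantCoeff (σ := τ) (R := k))) ^ N := by
      have h2 := Ideal.mem_map_of_mem H (mem_span_X_pow hf)
      rw [Ideal.map_pow, Ideal.map_span] at h2
      refine Ideal.pow_right_mono (Ideal.span_le.2 ?_) N h2
      rintro _ ⟨_, ⟨i, rfl⟩, rfl⟩
      exact hH i
    have h3 : ∀ (M : ℕ) (p : MvPowerSeries τ k),
        p ∈ (RingHom.ker (constantCoeff (σ := τ) (R := k))) ^ M → (M : ℕ∞) ≤ p.order := by
      intro M
      induction M with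
      | zero => simp
      | succ M ih =>
        intro p hp
        rw [pow_succ] at hp
        refine Submodule.mul_induction_on hp (fun a ha b hb => ?_) fun a b ha hb => ?_
        · refine le_trans ?_ le_order_mul
          push_cast
          exact add_le_add (ih a ha) (one_le_order_iff_constCoeff_eq_zero.2 hb)
        · exact le_trans (le_min ha hb) min_order_le_add
    exact coeff_of_lt_order (lt_of_lt_of_le (by exact_mod_cast he) (h3 N _ h1))
  have hpoly : F.comp (MvPolynomial.coeToMvPowerSeries.algHom k) =
      G.comp (MvPolynomial.coeToMvPowerSeries.algHom k) := by
    ext1 i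
    simpa [MvPolynomial.coeToMvPowerSeries.algHom_apply] using h i
  ext f e
  set N := e.degree + 1
  set p := truncTotal N f
  have hd : ∀ d : σ →₀ ℕ, d.degree < N →
      coeff d (f - MvPolynomial.coeToMvPowerSeries.algHom k p) = 0 := by
    intro d hd
    simp [p, MvPolynomial.coeToMvPowerSeries.algHom_apply, coeff_truncTotal, hd]
  have hF := hmap F h0 N _ hd e (Nat.lt_succ_self _)
  have hG := hmap G (fun i => h i ▸ h0 i) N _ hd e (Nat.lt_succ_self _)
  rw [map_sub, map_sub, sub_eq_zero] at hF hG
  rw [hF, hG]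
  exact congrArg _ (DFunLike.congr_fun hpoly p)

end MvPowerSeries

variable {𝕜 m n}

theorem IsDetPhi.rename_inl_mem_range (hn : 1 ≤ n) {φ : DetR 𝕜 m n →ₐ[𝕜] DetS 𝕜 m n}
    (hφ : IsDetPhi 𝕜 m n φ) (h : MvPowerSeries (Fin m) 𝕜) : rename Sum.inl h ∈ φ.range := by
  have e : (φ.comp (Ideal.Quotient.mkₐ 𝕜 (detI2 𝕜 m n))).comp
      (rename fun i : Fin m => (i, (⟨n - 1, by omega⟩ : Fin n))) =
      rename (R := 𝕜) (Sum.inl : Fin m → Fin m ⊕ Fin (n - 1)) := by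
    have hX (i : Fin m) : φ (Ideal.Quotient.mk (detI2 𝕜 m n) (X (i, ⟨n - 1, by omega⟩))) =
        X (Sum.inl i) := (hφ i ⟨n - 1, by omega⟩).trans (dif_neg (lt_irrefl _))
    refine algHom_ext_of_constantCoeff _ _ (fun i => ?_) fun i => ?_ <;> simp [hX]
  rw [← e]
  exact ⟨_, rfl⟩

theorem IsDetPhi.mem_range_of_support (hn : 1 ≤ n) {φ : DetR 𝕜 m n →ₐ[𝕜] DetS 𝕜 m n}
    (hφ : IsDetPhi 𝕜 m n φ) {g : DetS 𝕜 m n}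
    (hg : ∀ e, coeff e g ≠ 0 → ∀ j, e (Sum.inr j) = 0) : g ∈ φ.range := by
  classical
  let ι : Fin m ↪ Fin m ⊕ Fin (n - 1) := ⟨Sum.inl, Sum.inl_injective⟩
  let h : MvPowerSeries (Fin m) 𝕜 := fun u => coeff (Finsupp.embDomain ι u) g
  convert hφ.rename_inl_mem_range hn h
  ext e
  by_cases he : e ∈ Set.range (Finsupp.mapDomain (M := ℕ) ι)
  · obtain ⟨u, rfl⟩ := he
    rw [← Finsupp.embDomain_eq_mapDomain]
    exact (coeff_embDomain_rename ι h u).symm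
  · refine Eq.trans ?_ (coeff_rename_eq_zero ι h he).symm
    by_contra h0
    refine he ?_
    have hs : (e.support : Set (Fin m ⊕ Fin (n - 1))) ⊆ Set.range ι := by
      rintro (i | j) hi
      · exact ⟨i, rfl⟩
      · exact absurd (hg e h0 j) (by simpa using hi)
    exact ⟨e.comapDomain ι ι.injective.injOn,
      Finsupp.mapDomain_comapDomain _ ι.injective _ hs⟩

theorem IsDetPhi.monomial_mem_range (hn : 1 ≤ n) {φ : DetR 𝕜 m n →ₐ[𝕜] DetS 𝕜 m n}
    (hφ : IsDetPhi 𝕜 m n φ) (t : Fin m ⊕ Fin (n - 1) →₀ ℕ)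
    (ht : ∑ i, t (Sum.inl i) = ∑ j, t (Sum.inr j)) :
    (monomial t 1 : DetS 𝕜 m n) ∈ φ.range := by
  classical
  induction hN : ∑ i, t (Sum.inl i) generalizing t with
  | zero =>
    have : t = 0 := by
      rw [hN] at ht
      ext (i | j)
      · exact (Finset.sum_eq_zero_iff.1 hN) i (Finset.mem_univ _)
      · exact (Finset.sum_eq_zero_iff.1 ht.symm) j (Finset.mem_univ _)
    rw [this]
    exact one_mem φ.range
  | succ N ih =>
    obtain ⟨i, -, hi⟩ := Finset.exists_ne_zero_of_sum_ne_zero (by rw [hN]; simp :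
      ∑ i, t (Sum.inl i) ≠ 0)
    obtain ⟨j, -, hj⟩ := Finset.exists_ne_zero_of_sum_ne_zero (by rw [← ht, hN]; simp :
      ∑ j, t (Sum.inr j) ≠ 0)
    let s : Fin m ⊕ Fin (n - 1) →₀ ℕ :=
      Finsupp.single (Sum.inr j) 1 + Finsupp.single (Sum.inl i) 1
    have hs : s ≤ t := by
      rintro (a | b)
      · by_cases h : a = i
        · subst h; simpa [s] using Nat.one_le_iff_ne_zero.2 hi
        · simp [s, Ne.symm h]
      · by_cases h : b = j
        · subst h; simpa [s] using Nat.one_le_iff_ne_zero.2 hj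
        · simp [s, Ne.symm h]
    obtain ⟨t', rfl⟩ := exists_add_of_le hs
    have hl : ∑ i, (s + t') (Sum.inl i) = 1 + ∑ i, t' (Sum.inl i) := by
      simp [s, Finset.sum_add_distrib, Finsupp.single_apply]
    have hr : ∑ j, (s + t') (Sum.inr j) = 1 + ∑ j, t' (Sum.inr j) := by
      simp [s, Finset.sum_add_distrib, Finsupp.single_apply]
    have hst : (monomial (s + t') 1 : DetS 𝕜 m n) =
        X (Sum.inr j) * X (Sum.inl i) * monomial t' 1 := by
      rw [X_def, X_def, monomial_mul_monomial, monomial_mul_monomial]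
      simp [s]
    rw [hst]
    refine mul_mem ⟨detx 𝕜 m n i ⟨j, by omega⟩, ?_⟩ (ih t' (by omega) (by omega))
    exact (hφ i ⟨j, by omega⟩).trans (dif_pos j.2)

theorem monomial_mem_detA_pow (t : Fin m ⊕ Fin (n - 1) →₀ ℕ) :
    (monomial t 1 : DetS 𝕜 m n) ∈ detA 𝕜 m n ^ ∑ j, t (Sum.inr j) := by
  rw [monomial_one_eq, Finsupp.prod_fintype _ _ (by simp), Fintype.prod_sum_type,
    ← Finset.prod_pow_eq_pow_sum]
  have hX (j : Fin (n - 1)) : (X (Sum.inr j) : DetS 𝕜 m n) ∈ detA 𝕜 m n :=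
    Ideal.subset_span ⟨j, rfl⟩
  exact Ideal.mul_mem_left _ _ (Ideal.prod_mem_prod fun j _ => Ideal.pow_mem_pow (hX j) _)

/-- Split off from an exponent `d` a piece `t ≤ d` of bounded degree: either `t` has degree `α` in
the `a`-variables, or `t` is balanced and contains all `a`-variables of `d`, or `t = d`. -/
theorem exists_exponent_le (α : ℕ) (d : Fin m ⊕ Fin (n - 1) →₀ ℕ) :
    ∃ t ≤ d, t.degree ≤ 2 * α ∧
      (∑ j, t (Sum.inr j) = α ∨
        (∑ i, t (Sum.inl i) = ∑ j, t (Sum.inr j) ∧ ∀ j, t (Sum.inr j) = d (Sum.inr j)) ∨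
        ((∑ j, t (Sum.inr j) ≠ α) ∧ (∑ i, t (Sum.inl i) ≠ ∑ j, t (Sum.inr j)) ∧ t = d)) := by
  obtain ⟨⟨u, v⟩, rfl⟩ := Finsupp.sumFinsuppEquivProdFinsupp.symm.surjective d
  have hdeg (u : Fin m →₀ ℕ) (v : Fin (n - 1) →₀ ℕ) :
      (Finsupp.sumElim u v).degree = u.degree + v.degree := by
    simp [Finsupp.degree_eq_sum]
  have hle {u u' : Fin m →₀ ℕ} {v v' : Fin (n - 1) →₀ ℕ} (hu : u ≤ u') (hv : v ≤ v') :
      Finsupp.sumElim u v ≤ Finsupp.sumElim u' v' := by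
    rintro (i | j)
    · simpa using hu i
    · simpa using hv j
  change ∃ t ≤ Finsupp.sumElim u v, _
  by_cases h1 : α ≤ v.degree
  · obtain ⟨v', hv', hd⟩ := Finsupp.exists_le_degree_eq v α h1
    refine ⟨Finsupp.sumElim 0 v', hle (zero_le) hv', ?_, Or.inl ?_⟩
    · rw [hdeg, hd]; simp; omega
    · simpa [Finsupp.degree_eq_sum] using hd
  by_cases h2 : v.degree ≤ u.degree
  · obtain ⟨u', hu', hd⟩ := Finsupp.exists_le_degree_eq u _ h2
    refine ⟨Finsupp.sumElim u' v, hle hu' le_rfl, ?_, Or.inr (Or.inl ⟨?_, fun j => ?_⟩)⟩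
    · rw [hdeg, hd]; omega
    · simpa [Finsupp.degree_eq_sum] using hd
    · simp [Finsupp.sumFinsuppEquivProdFinsupp]
  · refine ⟨Finsupp.sumElim u v, le_rfl, ?_, Or.inr (Or.inr ⟨?_, ?_, rfl⟩)⟩
    · rw [hdeg]; omega
    · simp only [Finsupp.degree_eq_sum] at h1
      simp; omega
    · simp only [Finsupp.degree_eq_sum] at h2
      simp; omega

theorem IsDetPhi.mem_sup_span_monomial (hn : 1 ≤ n) {φ : DetR 𝕜 m n →ₐ[𝕜] DetS 𝕜 m n}
    (hφ : IsDetPhi 𝕜 m n φ) (α : ℕ) (f : DetS 𝕜 m n) :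
    f ∈ Subalgebra.toSubmodule φ.range ⊔ (detA 𝕜 m n ^ α).restrictScalars 𝕜 ⊔
      Submodule.span 𝕜 ((fun t => (monomial t 1 : DetS 𝕜 m n)) '' {t | t.degree ≤ 2 * α}) := by
  choose c hc hdeg hcase using exists_exponent_le (m := m) (n := n) α
  obtain ⟨g, hg, hf⟩ := eq_sum_monomial_mul f
    (Finsupp.finite_of_degree_le (σ := Fin m ⊕ Fin (n - 1)) (2 * α)).toFinset c
    (fun d _ => by simpa using hdeg d) hc
  rw [hf]
  refine Submodule.sum_mem _ fun t ht => ?_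
  by_cases h1 : ∑ j, t (Sum.inr j) = α
  · refine Submodule.mem_sup_left (Submodule.mem_sup_right ?_)
    exact Ideal.mul_mem_right _ _ (h1 ▸ monomial_mem_detA_pow t)
  by_cases h2 : ∑ i, t (Sum.inl i) = ∑ j, t (Sum.inr j)
  · refine Submodule.mem_sup_left (Submodule.mem_sup_left ?_)
    refine Subalgebra.mul_mem φ.range (hφ.monomial_mem_range hn t h2) (hφ.mem_range_of_support hn fun e he j => ?_)
    have h := hcase (e + t)
    rw [hg t e he] at h
    rcases h with h | ⟨-, h⟩ | ⟨-, h, -⟩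
    · exact absurd h h1
    · simpa using h j
    · exact absurd h2 h
  · refine Submodule.mem_sup_right ?_
    have hC : g t = C (coeff 0 (g t)) := by
      classical
      ext e
      rw [coeff_C]
      split_ifs with he0
      · rw [he0]
      · by_contra he
        have h := hcase (e + t)
        rw [hg t e he] at h
        rcases h with h | ⟨h, -⟩ | ⟨-, -, h⟩
        · exact h1 h
        · exact h2 h
        · exact he0 (by simpa using h)
    rw [hC, mul_comm (monomial t (1 : 𝕜)), ← smul_eq_C_mul]
    exact Submodule.smul_mem _ _ (Submodule.subset_span ⟨t, by simpa using ht, rfl⟩)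

variable (𝕜 m n)

/-- for every `α ≥ 1`, the cokernel `C_α` of the injective homomorphism
`φ^α : R/I^α → S/𝔞^α S` has finite length as an `R`-module.  Here `S/𝔞^α S` is an
`R`-module via `φ`, and the image of `φ^α` is the `R`-submodule generated by the image of
`R`, i.e. the range of the structural `R`-linear map `R → S/𝔞^α S`. -/
theorem statement4 (hm : 2 ≤ m) (hn : 2 ≤ n)
    (φ : DetR 𝕜 m n →ₐ[𝕜] DetS 𝕜 m n) (hφ : IsDetPhi 𝕜 m n φ) (α : ℕ) (hα : 1 ≤ α) :
    haveI : Algebra (DetR 𝕜 m n) (DetS 𝕜 m n) := φ.toRingHom.toAlgebra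
    IsFiniteLength (DetR 𝕜 m n)
      ((DetS 𝕜 m n ⧸ detA 𝕜 m n ^ α) ⧸
        LinearMap.range (Algebra.linearMap (DetR 𝕜 m n) (DetS 𝕜 m n ⧸ detA 𝕜 m n ^ α))) := by
  let _ : Algebra (DetR 𝕜 m n) (DetS 𝕜 m n) := φ.toRingHom.toAlgebra
  have : IsScalarTower 𝕜 (DetR 𝕜 m n) (DetS 𝕜 m n) :=
    ⟨fun a r s => by
      change φ (a • r) * s = a • (φ r * s)
      rw [map_smul, smul_mul_assoc]⟩
  let p : Submodule (DetR 𝕜 m n) (DetS 𝕜 m n ⧸ detA 𝕜 m n ^ α) :=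
    LinearMap.range (Algebra.linearMap (DetR 𝕜 m n) (DetS 𝕜 m n ⧸ detA 𝕜 m n ^ α))
  let π : DetS 𝕜 m n →ₗ[𝕜] (DetS 𝕜 m n ⧸ detA 𝕜 m n ^ α) ⧸ p :=
    (p.mkQ.restrictScalars 𝕜).comp (Ideal.Quotient.mkₐ 𝕜 (detA 𝕜 m n ^ α)).toLinearMap
  have hπ : Function.Surjective π :=
    p.mkQ_surjective.comp (Ideal.Quotient.mkₐ_surjective 𝕜 (detA 𝕜 m n ^ α))
  let V : Submodule 𝕜 (DetS 𝕜 m n) :=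
    Submodule.span 𝕜 ((fun t => (monomial t 1 : DetS 𝕜 m n)) '' {t | t.degree ≤ 2 * α})
  have hV : V.FG := Submodule.fg_span ((Finsupp.finite_of_degree_le _).image _)
  have hker : Subalgebra.toSubmodule φ.range ⊔ (detA 𝕜 m n ^ α).restrictScalars 𝕜 ≤
      LinearMap.ker π := by
    refine sup_le ?_ fun a ha => ?_
    · rintro _ ⟨r, rfl⟩
      exact (Submodule.Quotient.mk_eq_zero p).2 ⟨r, rfl⟩
    · have h0 : Ideal.Quotient.mk (detA 𝕜 m n ^ α) a = 0 := Ideal.Quotient.eq_zero_iff_mem.2 ha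
      exact (congrArg p.mkQ h0).trans (map_zero _)
  have hfin : Module.Finite 𝕜 ((DetS 𝕜 m n ⧸ detA 𝕜 m n ^ α) ⧸ p) := by
    refine ⟨?_⟩
    have htop : V.map π = ⊤ := by
      refine eq_top_iff.2 fun x _ => ?_
      obtain ⟨f, rfl⟩ := hπ x
      obtain ⟨a, ha, v, hv, rfl⟩ :=
        Submodule.mem_sup.1 (hφ.mem_sup_span_monomial (by omega) α f)
      exact ⟨v, hv, by rw [map_add, LinearMap.mem_ker.1 (hker ha), zero_add]⟩
    exact htop ▸ hV.map π
  exact isFiniteLength_iff_isNoetherian_isArtinian.2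
    ⟨isNoetherian_of_tower 𝕜 inferInstance, isArtinian_of_tower 𝕜 inferInstance⟩
end
end
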